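/- arXiv:2604.23751 — 2 statements merged into one kernel-verified Lean document; each statement's English description precedes it below -/
import Mathlib

section
/- The map Ψ : D → M([0,1]²) defined by Ψ(π₁,π₂) := π₁↗π₂ + (Leb − π₁)↗(Leb − π₂) is continuous (for weak convergence on both sides) and its image equals exactly the set of 321-avoiding permutons. Moreover, for any 321-avoiding permuton μ, writing μ = μ_lr + μ_ul + μ_diag for its restrictions to {(x,y): x>y}, {(x,y): x<y} and {(x,y): x=y}, the fiber is Ψ⁻¹(μ) = { proj(μ_lr + ν) : ν is a measure with 0 ≤ ν ≤ μ_diag }, where proj(π) denotes the pair of pushforwards of a measure π on [0,1]² under the two coordinate projections. -/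
open MeasureTheory Filter Set

noncomputable section

/-- Lebesgue measure on `[0,1]`. -/
def Leb01 : Measure ℝ := volume.restrict (Set.Icc (0:ℝ) 1)

/-- A permuton: a Borel probability measure on the plane (supported on `[0,1]²`) whose
two marginals are the Lebesgue measure on `[0,1]`. -/
def IsPermuton (μ : Measure (ℝ × ℝ)) : Prop :=
  IsProbabilityMeasure μ ∧
    μ.map Prod.fst = Leb01 ∧ μ.map Prod.snd = Leb01

/-- A permuton avoids the pattern `321` if `μ⊗μ⊗μ` gives zero mass to triples of
points in relative position `321`. -/
def PermutonAvoids321 (μ : Measure (ℝ × ℝ)) : Prop :=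
  (μ.prod (μ.prod μ))
    {t : (ℝ × ℝ) × (ℝ × ℝ) × (ℝ × ℝ) |
      t.1.1 < t.2.1.1 ∧ t.2.1.1 < t.2.2.1 ∧ t.2.2.2 < t.2.1.2 ∧ t.2.1.2 < t.1.2} = 0

/-- The quantile function of a finite measure on `[0,1]`:
`G_μ(u) = sup{x ∈ [0,1] : μ([0,x]) ≤ u}`. -/
def quantileFun (μ : Measure ℝ) (u : ℝ) : ℝ :=
  sSup {x : ℝ | x ∈ Set.Icc (0:ℝ) 1 ∧ (μ (Set.Icc 0 x)).toReal ≤ u}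

/-- The nondecreasing coupling `μ↗ν` of two finite measures with the same total mass
`M`: the pushforward of `Leb_{(0,M)}` under `u ↦ (G_μ(u), G_ν(u))`. -/
def ndCoupling (μ ν : Measure ℝ) : Measure (ℝ × ℝ) :=
  (volume.restrict (Set.Ioo (0:ℝ) (μ Set.univ).toReal)).map
    (fun u => (quantileFun μ u, quantileFun ν u))

/-- The measure `Ψ(π₁,π₂) = π₁↗π₂ + (Leb−π₁)↗(Leb−π₂)`. -/
def PsiMeas (π₁ π₂ : Measure ℝ) : Measure (ℝ × ℝ) :=
  ndCoupling π₁ π₂ + ndCoupling (Leb01 - π₁) (Leb01 - π₂)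

/-- The defining property of the space `D`. -/
def MemD (π₁ π₂ : Measure ℝ) : Prop :=
  π₁ ≤ Leb01 ∧ π₂ ≤ Leb01 ∧ π₁ Set.univ = π₂ Set.univ ∧
    ∀ x : ℝ, π₁ (Set.Icc 0 x) ≤ π₂ (Set.Icc 0 x)

/-- The space `D` of pairs of subuniform measures on `[0,1]`, with equal total mass and
ordered cumulative distribution functions, equipped with the topology of weak
convergence. -/
def Dspace : Type :=
  {p : FiniteMeasure ℝ × FiniteMeasure ℝ //
    MemD (p.1 : Measure ℝ) (p.2 : Measure ℝ)}

instance : TopologicalSpace Dspace := by unfold Dspace; infer_instance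

open Topology

section SubLebesgue

variable {π μ ν : Measure ℝ} {u x y : ℝ}

instance : IsFiniteMeasure Leb01 := by unfold Leb01; infer_instance

lemma Leb01_le_volume : Leb01 ≤ volume := Measure.restrict_le_self

lemma isFiniteMeasure_of_le_Leb01 (h : π ≤ Leb01) : IsFiniteMeasure π :=
  isFiniteMeasure_of_le _ h

lemma measure_eq_zero_of_le_Leb01 (h : π ≤ Leb01) {s : Set ℝ} (hs : Leb01 s = 0) : π s = 0 :=
  le_antisymm ((h s).trans hs.le) zero_le

lemma Leb01_Iio_zero : Leb01 (Iio 0) = 0 := by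
  rw [Leb01, Measure.restrict_apply measurableSet_Iio]
  have : Iio (0 : ℝ) ∩ Icc 0 1 = ∅ := by ext z; simp; intros; linarith
  simp [this]

lemma Leb01_Ioi_one : Leb01 (Ioi 1) = 0 := by
  rw [Leb01, Measure.restrict_apply measurableSet_Ioi]
  have : Ioi (1 : ℝ) ∩ Icc 0 1 = ∅ := by ext z; simp; intros; linarith
  simp [this]

lemma Leb01_singleton (x : ℝ) : Leb01 {x} = 0 :=
  le_antisymm ((Leb01_le_volume {x}).trans (by simp)) zero_le

lemma Leb01_univ : Leb01 univ = 1 := by simp [Leb01]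

lemma measure_Icc_eq_Iio (h : π ≤ Leb01) (x : ℝ) : π (Icc 0 x) = π (Iio x) := by
  apply le_antisymm
  · calc π (Icc 0 x) ≤ π (Iio x ∪ {x}) := measure_mono fun z hz => by
          rcases hz.2.lt_or_eq with h | h
          · exact Or.inl h
          · exact Or.inr h
      _ ≤ π (Iio x) + π {x} := measure_union_le _ _
      _ = π (Iio x) := by rw [measure_eq_zero_of_le_Leb01 h (Leb01_singleton x), add_zero]
  · calc π (Iio x) ≤ π (Icc 0 x ∪ Iio 0) := measure_mono fun z hz => by
          rcases lt_or_ge z 0 with h | h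
          · exact Or.inr h
          · exact Or.inl ⟨h, le_of_lt hz⟩
      _ ≤ π (Icc 0 x) + π (Iio 0) := measure_union_le _ _
      _ = π (Icc 0 x) := by rw [measure_eq_zero_of_le_Leb01 h Leb01_Iio_zero, add_zero]

lemma measure_Iic_eq_Iio (h : π ≤ Leb01) (x : ℝ) : π (Iic x) = π (Iio x) := by
  apply le_antisymm _ (measure_mono Iio_subset_Iic_self)
  rw [← Iio_union_right]
  refine (measure_union_le _ _).trans ?_
  rw [measure_eq_zero_of_le_Leb01 h (Leb01_singleton x), add_zero]

lemma measure_Iio_eq_univ (h : π ≤ Leb01) (hx : 1 < x) : π (Iio x) = π univ := by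
  apply le_antisymm (measure_mono (subset_univ _))
  calc π univ ≤ π (Iio x ∪ Ioi 1) := measure_mono fun z _ => by
        rcases lt_or_ge z x with h | h
        · exact Or.inl h
        · exact Or.inr (lt_of_lt_of_le hx h)
    _ ≤ π (Iio x) + π (Ioi 1) := measure_union_le _ _
    _ = π (Iio x) := by rw [measure_eq_zero_of_le_Leb01 h Leb01_Ioi_one, add_zero]

lemma measureReal_Iio_le_add (h : π ≤ Leb01) (hxy : y ≤ x) :
    π.real (Iio x) ≤ π.real (Iio y) + (x - y) := by
  have := isFiniteMeasure_of_le_Leb01 h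
  have h1 : π (Iio x) ≤ π (Iio y) + ENNReal.ofReal (x - y) := by
    rw [← Iio_union_Ico_eq_Iio hxy]
    refine (measure_union_le _ _).trans (add_le_add_right ?_ _)
    calc π (Ico y x) ≤ volume (Ico y x) := (h.trans Leb01_le_volume) _
      _ = _ := by simp
  have h2 := ENNReal.toReal_mono (by finiteness) h1
  rwa [ENNReal.toReal_add (by finiteness) (by finiteness),
    ENNReal.toReal_ofReal (by linarith)] at h2

lemma quantileSet_bddAbove (π : Measure ℝ) (u : ℝ) :
    BddAbove {x : ℝ | x ∈ Icc (0:ℝ) 1 ∧ (π (Icc 0 x)).toReal ≤ u} :=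
  ⟨1, fun _ hx => hx.1.2⟩

lemma quantileFun_nonneg (π : Measure ℝ) (u : ℝ) : 0 ≤ quantileFun π u :=
  Real.sSup_nonneg fun _ hx => hx.1.1

lemma zero_mem_quantileSet (h : π ≤ Leb01) (hu : 0 ≤ u) :
    (0:ℝ) ∈ {x : ℝ | x ∈ Icc (0:ℝ) 1 ∧ (π (Icc 0 x)).toReal ≤ u} := by
  refine ⟨by simp, ?_⟩
  rw [measure_Icc_eq_Iio h, measure_eq_zero_of_le_Leb01 h Leb01_Iio_zero]
  simpa using hu

lemma quantileFun_lt_iff (h : π ≤ Leb01) (hu : u ∈ Ioo 0 (π univ).toReal) :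
    quantileFun π u < x ↔ u < π.real (Iio x) := by
  have := isFiniteMeasure_of_le_Leb01 h
  constructor
  · intro hx
    by_contra! hle
    by_cases hx1 : 1 < x
    · rw [measureReal_def, measure_Iio_eq_univ h hx1] at hle
      exact absurd hu.2 (not_lt.2 hle)
    · refine absurd (le_csSup (quantileSet_bddAbove π u) ⟨⟨?_, not_lt.1 hx1⟩, ?_⟩) (not_le.2 hx)
      · exact (quantileFun_nonneg π u).trans hx.le
      · rwa [measure_Icc_eq_Iio h]
  · intro hx
    by_contra! hle
    refine absurd hx (not_lt.2 (le_of_forall_pos_le_add fun ε hε => ?_))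
    obtain ⟨z, hz, hyz⟩ := exists_lt_of_lt_csSup ⟨0, zero_mem_quantileSet h hu.1.le⟩
      (lt_of_lt_of_le (sub_lt_self x hε) hle)
    have h1 := measureReal_Iio_le_add h (sub_le_self x hε.le)
    have h2 : π.real (Iio (x - ε)) ≤ π.real (Iio z) :=
      measureReal_mono (Iio_subset_Iio hyz.le)
    have h3 := hz.2
    rw [measure_Icc_eq_Iio h, ← measureReal_def] at h3
    linarith

lemma quantileFun_monotone (h : π ≤ Leb01) : Monotone (quantileFun π) := by
  intro u v huv
  rcases lt_or_ge u 0 with hu | hu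
  · have : {x : ℝ | x ∈ Icc (0:ℝ) 1 ∧ (π (Icc 0 x)).toReal ≤ u} = ∅ := by
      ext z
      simp only [mem_ofPred_eq, mem_empty_iff_false, iff_false, not_and, not_le]
      exact fun _ => lt_of_lt_of_le hu ENNReal.toReal_nonneg
    rw [quantileFun, this, Real.sSup_empty]
    exact quantileFun_nonneg π v
  · exact csSup_le_csSup (quantileSet_bddAbove π v) ⟨0, zero_mem_quantileSet h hu⟩
      fun z hz => ⟨hz.1, hz.2.trans huv⟩

lemma quantileFun_anti (hν : ν ≤ Leb01)
    (hle : ∀ x, μ (Icc 0 x) ≤ ν (Icc 0 x)) (hu : 0 ≤ u) :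
    quantileFun ν u ≤ quantileFun μ u := by
  have := isFiniteMeasure_of_le_Leb01 hν
  exact csSup_le_csSup (quantileSet_bddAbove μ u) ⟨0, zero_mem_quantileSet hν hu⟩
    fun z hz => ⟨hz.1, (ENNReal.toReal_mono (by finiteness) (hle z)).trans hz.2⟩

lemma measurable_quantilePair (hμ : μ ≤ Leb01) (hν : ν ≤ Leb01) :
    Measurable fun u => (quantileFun μ u, quantileFun ν u) :=
  (quantileFun_monotone hμ).measurable.prodMk (quantileFun_monotone hν).measurable

lemma map_quantileFun (h : π ≤ Leb01) :
    (volume.restrict (Ioo (0:ℝ) (π univ).toReal)).map (quantileFun π) = π := by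
  have := isFiniteMeasure_of_le_Leb01 h
  have hm := (quantileFun_monotone h).measurable
  have key : ∀ x, (volume.restrict (Ioo (0:ℝ) (π univ).toReal)).map (quantileFun π) (Iio x)
      = π (Iio x) := by
    intro x
    rw [Measure.map_apply hm measurableSet_Iio, Measure.restrict_apply (hm measurableSet_Iio)]
    have : quantileFun π ⁻¹' Iio x ∩ Ioo 0 (π univ).toReal = Ioo 0 (π.real (Iio x)) := by
      ext u
      simp only [mem_inter_iff, mem_preimage, mem_Iio]
      constructor
      · rintro ⟨h1, h2⟩
        exact ⟨h2.1, (quantileFun_lt_iff h h2).1 h1⟩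
      · rintro ⟨h1, h2⟩
        have h3 : u ∈ Ioo 0 (π univ).toReal :=
          ⟨h1, h2.trans_le (measureReal_mono (subset_univ _))⟩
        exact ⟨(quantileFun_lt_iff h h3).2 h2, h3⟩
    rw [this]
    simp [measureReal_def]
  refine ext_of_generate_finite (range Iio) (BorelSpace.measurable_eq.trans
    (borel_eq_generateFrom_Iio ℝ)) isPiSystem_Iio ?_ ?_
  · rintro _ ⟨x, rfl⟩
    exact key x
  · simp [Measure.map_apply hm MeasurableSet.univ]

lemma ndCoupling_map_fst (hμ : μ ≤ Leb01) (hν : ν ≤ Leb01) :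
    (ndCoupling μ ν).map Prod.fst = μ := by
  rw [ndCoupling, Measure.map_map measurable_fst (measurable_quantilePair hμ hν)]
  exact map_quantileFun hμ

lemma ndCoupling_map_snd (hμ : μ ≤ Leb01) (hν : ν ≤ Leb01) (hm : μ univ = ν univ) :
    (ndCoupling μ ν).map Prod.snd = ν := by
  rw [ndCoupling, Measure.map_map measurable_snd (measurable_quantilePair hμ hν), hm]
  exact map_quantileFun hν

instance : IsFiniteMeasure (ndCoupling μ ν) := by unfold ndCoupling; infer_instance

lemma ndCoupling_ae_snd_le_fst (hμ : μ ≤ Leb01) (hν : ν ≤ Leb01)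
    (hle : ∀ x, μ (Icc 0 x) ≤ ν (Icc 0 x)) : ∀ᵐ z ∂(ndCoupling μ ν), z.2 ≤ z.1 := by
  rw [ndCoupling, ae_map_iff (measurable_quantilePair hμ hν).aemeasurable
    (measurableSet_le measurable_snd measurable_fst)]
  filter_upwards [ae_restrict_mem measurableSet_Ioo] with u hu
  exact quantileFun_anti hν hle hu.1.le

lemma ndCoupling_ae_fst_le_snd (hμ : μ ≤ Leb01) (hν : ν ≤ Leb01)
    (hle : ∀ x, ν (Icc 0 x) ≤ μ (Icc 0 x)) : ∀ᵐ z ∂(ndCoupling μ ν), z.1 ≤ z.2 := by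
  rw [ndCoupling, ae_map_iff (measurable_quantilePair hμ hν).aemeasurable
    (measurableSet_le measurable_fst measurable_snd)]
  filter_upwards [ae_restrict_mem measurableSet_Ioo] with u hu
  exact quantileFun_anti hμ hle hu.1.le

end SubLebesgue

section WeakChain

/-- A set of points in the plane no two of which form a descent. -/
def IsWeakChain (C : Set (ℝ × ℝ)) : Prop :=
  ∀ s ∈ C, ∀ t ∈ C, s.1 < t.1 → s.2 ≤ t.2

lemma IsWeakChain.closure {C : Set (ℝ × ℝ)} (hC : IsWeakChain C) : IsWeakChain (closure C) := by
  have hcl : IsClosed {p : (ℝ × ℝ) × (ℝ × ℝ) | p.2.1 ≤ p.1.1 ∨ p.1.2 ≤ p.2.2} :=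
    IsClosed.union (s₁ := {p : (ℝ × ℝ) × (ℝ × ℝ) | p.2.1 ≤ p.1.1})
      (s₂ := {p : (ℝ × ℝ) × (ℝ × ℝ) | p.1.2 ≤ p.2.2})
      (isClosed_le (by fun_prop) (by fun_prop)) (isClosed_le (by fun_prop) (by fun_prop))
  have hsub : C ×ˢ C ⊆ {p : (ℝ × ℝ) × (ℝ × ℝ) | p.2.1 ≤ p.1.1 ∨ p.1.2 ≤ p.2.2} := by
    rintro ⟨s, t⟩ ⟨hs, ht⟩
    rcases lt_or_ge s.1 t.1 with h | h
    · exact Or.inr (hC s hs t ht h)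
    · exact Or.inl h
  intro s hs t ht hst
  have := closure_minimal hsub hcl (by rw [closure_prod_eq]; exact ⟨hs, ht⟩ : (s, t) ∈ _)
  exact this.resolve_left (not_le.2 hst)

lemma ndCoupling_ae_mem_weakChain {μ ν : Measure ℝ} (hμ : μ ≤ Leb01) (hν : ν ≤ Leb01) :
    ∃ C, IsWeakChain C ∧ ∀ᵐ z ∂(ndCoupling μ ν), z ∈ C := by
  refine ⟨closure (range fun u => (quantileFun μ u, quantileFun ν u)), ?_, ?_⟩
  · apply IsWeakChain.closure
    rintro _ ⟨u, rfl⟩ _ ⟨v, rfl⟩ h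
    exact quantileFun_monotone hν ((quantileFun_monotone hμ).reflect_lt h).le
  · exact (ae_map_iff (measurable_quantilePair hμ hν).aemeasurable
      isClosed_closure.measurableSet).2 (ae_of_all _ fun u => subset_closure ⟨u, rfl⟩)

/-- A finite measure carried by a weak chain has the values of the nondecreasing coupling on
quadrants. -/
lemma measure_Iio_prod_Iio_of_weakChain {ρ : Measure (ℝ × ℝ)}
    {C : Set (ℝ × ℝ)} (hC : IsWeakChain C) (hρ : ∀ᵐ z ∂ρ, z ∈ C) (x y : ℝ) :
    ρ (Iio x ×ˢ Iio y) = min (ρ.map Prod.fst (Iio x)) (ρ.map Prod.snd (Iio y)) := by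
  rw [Measure.map_apply measurable_fst measurableSet_Iio,
    Measure.map_apply measurable_snd measurableSet_Iio]
  have hX : ρ (Iio x ×ˢ Iio y) ≤ ρ (Prod.fst ⁻¹' Iio x) := measure_mono fun z hz => hz.1
  have hY : ρ (Iio x ×ˢ Iio y) ≤ ρ (Prod.snd ⁻¹' Iio y) := measure_mono fun z hz => hz.2
  apply le_antisymm (le_min hX hY)
  by_cases hs : ∃ s ∈ C, s.1 < x ∧ y ≤ s.2
  · obtain ⟨s, hsC, hsx, hsy⟩ := hs
    refine (min_le_right _ _).trans (measure_mono_ae ?_)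
    filter_upwards [hρ] with t ht hty
    refine ⟨?_, hty⟩
    by_contra hx
    have h1 := hC s hsC t ht (lt_of_lt_of_le hsx (not_lt.1 hx))
    exact absurd (show t.2 < y from hty) (not_lt.2 (hsy.trans h1))
  · push Not at hs
    refine (min_le_left _ _).trans (measure_mono_ae ?_)
    filter_upwards [hρ] with t ht htx
    exact ⟨htx, hs t ht htx⟩

lemma measure_ext_of_Iio_prod_Iio {ρ σ : Measure (ℝ × ℝ)} [IsFiniteMeasure ρ]
    (hu : ρ univ = σ univ) (h : ∀ x y : ℝ, ρ (Iio x ×ˢ Iio y) = σ (Iio x ×ˢ Iio y)) : ρ = σ := by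
  have hspan : IsCountablySpanning (range Iio : Set (Set ℝ)) := by
    refine ⟨fun n : ℕ => Iio (n : ℝ), fun n => ⟨_, rfl⟩, ?_⟩
    exact iUnion_eq_univ_iff.2 fun x => exists_nat_gt x
  have hgen : (borel ℝ) = MeasurableSpace.generateFrom (range Iio) := borel_eq_generateFrom_Iio ℝ
  refine ext_of_generate_finite (image2 (· ×ˢ ·) (range Iio) (range Iio)) ?_
    (isPiSystem_Iio.prod isPiSystem_Iio) ?_ hu
  · rw [← generateFrom_prod_eq hspan hspan, ← hgen, ← BorelSpace.measurable_eq]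
  · rintro _ ⟨_, ⟨x, rfl⟩, _, ⟨y, rfl⟩, rfl⟩
    exact h x y

lemma ndCoupling_map_eq_of_weakChain {ρ : Measure (ℝ × ℝ)} [IsFiniteMeasure ρ]
    {C : Set (ℝ × ℝ)} (hC : IsWeakChain C) (hρ : ∀ᵐ z ∂ρ, z ∈ C)
    (h₁ : ρ.map Prod.fst ≤ Leb01) (h₂ : ρ.map Prod.snd ≤ Leb01) :
    ndCoupling (ρ.map Prod.fst) (ρ.map Prod.snd) = ρ := by
  have hm : ρ.map Prod.fst univ = ρ.map Prod.snd univ := by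
    rw [Measure.map_apply measurable_fst .univ, Measure.map_apply measurable_snd .univ]; rfl
  have hf := ndCoupling_map_fst h₁ h₂
  have hs := ndCoupling_map_snd h₁ h₂ hm
  obtain ⟨C', hC', hC'ae⟩ := ndCoupling_ae_mem_weakChain h₁ h₂
  apply measure_ext_of_Iio_prod_Iio
  · have := congrArg (fun m => m univ) hf
    simpa [Measure.map_apply measurable_fst MeasurableSet.univ] using this
  · intro x y
    rw [measure_Iio_prod_Iio_of_weakChain hC hρ, measure_Iio_prod_Iio_of_weakChain hC' hC'ae,
      hf, hs]

end WeakChain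

section Avoidance

variable {μ ρ σ : Measure (ℝ × ℝ)}

lemma permutonAvoids321_of_weakChains [IsFiniteMeasure μ] {A B : Set (ℝ × ℝ)}
    (hA : IsWeakChain A) (hB : IsWeakChain B) (hμ : ∀ᵐ z ∂μ, z ∈ A ∪ B) :
    PermutonAvoids321 μ := by
  have h₁ : ∀ᵐ t ∂(μ.prod (μ.prod μ)), t.1 ∈ A ∪ B :=
    Measure.quasiMeasurePreserving_fst.ae hμ
  have h₂ : ∀ᵐ t ∂(μ.prod (μ.prod μ)), t.2.1 ∈ A ∪ B :=
    (Measure.quasiMeasurePreserving_fst.comp Measure.quasiMeasurePreserving_snd).ae hμ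
  have h₃ : ∀ᵐ t ∂(μ.prod (μ.prod μ)), t.2.2 ∈ A ∪ B :=
    (Measure.quasiMeasurePreserving_snd.comp Measure.quasiMeasurePreserving_snd).ae hμ
  refine measure_eq_zero_iff_ae_notMem.2 ?_
  filter_upwards [h₁, h₂, h₃] with ⟨r, s, t⟩ hr hs ht ⟨h1, h2, h3, h4⟩
  simp only at hr hs ht h1 h2 h3 h4
  have key : ∀ C, IsWeakChain C → ¬ (r ∈ C ∧ s ∈ C) ∧ ¬ (s ∈ C ∧ t ∈ C) ∧ ¬ (r ∈ C ∧ t ∈ C) :=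
    fun C hC => ⟨fun h => absurd (hC r h.1 s h.2 h1) (not_le.2 h4),
      fun h => absurd (hC s h.1 t h.2 h2) (not_le.2 h3),
      fun h => absurd (hC r h.1 t h.2 (h1.trans h2)) (not_le.2 (h3.trans h4))⟩
  have := key A hA
  have := key B hB
  simp only [mem_union] at hr hs ht
  tauto

lemma PermutonAvoids321.not_descent_of_mem_support [IsFiniteMeasure μ] (h : PermutonAvoids321 μ)
    {r s t : ℝ × ℝ} (hr : r ∈ μ.support) (hs : s ∈ μ.support) (ht : t ∈ μ.support)
    (h₁ : r.1 < s.1) (h₂ : s.1 < t.1) (h₃ : t.2 < s.2) (h₄ : s.2 < r.2) : False := by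
  obtain ⟨a, ha, ha'⟩ := exists_between h₁
  obtain ⟨b, hb, hb'⟩ := exists_between h₂
  obtain ⟨d, hd, hd'⟩ := exists_between h₃
  obtain ⟨c, hc, hc'⟩ := exists_between h₄
  rw [Measure.support_eq_forall_isOpen] at hr hs ht
  have pr := hr (Iio a ×ˢ Ioi c) ⟨ha, hc'⟩ (isOpen_Iio.prod isOpen_Ioi)
  have ps := hs (Ioo a b ×ˢ Ioo d c) ⟨⟨ha', hb⟩, ⟨hd', hc⟩⟩ (isOpen_Ioo.prod isOpen_Ioo)
  have pt := ht (Ioi b ×ˢ Iio d) ⟨hb', hd⟩ (isOpen_Ioi.prod isOpen_Iio)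
  have hpos : 0 < (μ.prod (μ.prod μ))
      ((Iio a ×ˢ Ioi c) ×ˢ ((Ioo a b ×ˢ Ioo d c) ×ˢ (Ioi b ×ˢ Iio d))) := by
    rw [Measure.prod_prod, Measure.prod_prod]
    exact ENNReal.mul_pos pr.ne' (ENNReal.mul_pos ps.ne' pt.ne').ne'
  refine hpos.ne' (measure_mono_null ?_ h)
  rintro ⟨u, v, w⟩ ⟨hu, hv, hw⟩
  exact ⟨lt_trans hu.1 hv.1.1, lt_trans hv.1.2 hw.1, lt_trans hw.2 hv.2.1,
    lt_trans hv.2.2 hu.2⟩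

lemma exists_mem_support_of_measure_pos {s : Set (ℝ × ℝ)} (hs : 0 < μ s) :
    ∃ r ∈ μ.support, r ∈ s := by
  by_contra! hcon
  refine hs.ne' (measure_eq_zero_iff_ae_notMem.2 ?_)
  filter_upwards [Measure.support_mem_ae (μ := μ)] with z hz
  exact hcon z hz

lemma IsPermuton.measure_fst (h : IsPermuton μ) {s : Set ℝ} (hs : MeasurableSet s) :
    μ (Prod.fst ⁻¹' s) = Leb01 s := by
  rw [← h.2.1, Measure.map_apply measurable_fst hs]

lemma IsPermuton.measure_snd (h : IsPermuton μ) {s : Set ℝ} (hs : MeasurableSet s) :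
    μ (Prod.snd ⁻¹' s) = Leb01 s := by
  rw [← h.2.2, Measure.map_apply measurable_snd hs]

lemma IsPermuton.measure_upper_left_pos (h : IsPermuton μ) {x y : ℝ} (hyx : y ≤ x)
    (hpos : 0 < μ (Ioi x ×ˢ Iio y)) : 0 < μ (Iio x ×ˢ Ioi y) := by
  have := h.1
  by_contra! h0
  have h0 := nonpos_iff_eq_zero.1 h0
  have h1 : μ (Prod.fst ⁻¹' Iio x) ≤ μ (Iio x ×ˢ Iic y) := by
    calc _ ≤ μ (Iio x ×ˢ Iic y ∪ Iio x ×ˢ Ioi y) := measure_mono fun z hz =>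
          (le_or_gt z.2 y).imp (fun h => ⟨hz, h⟩) (fun h => ⟨hz, h⟩)
      _ ≤ _ := (measure_union_le _ _).trans (by rw [h0, add_zero])
  have h2 : μ (Iio x ×ˢ Iic y) + μ (Ioi x ×ˢ Iio y) ≤ μ (Prod.snd ⁻¹' Iic y) := by
    rw [← measure_union _ (measurableSet_Ioi.prod measurableSet_Iio)]
    · refine measure_mono ?_
      rintro z (hz | hz)
      · exact hz.2
      · exact (mem_Iio.1 hz.2).le
    · rw [Set.disjoint_left]
      exact fun z hz hz' => lt_asymm (show z.1 < x from hz.1) hz'.1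
  rw [h.measure_fst measurableSet_Iio] at h1
  rw [h.measure_snd measurableSet_Iic, measure_Iic_eq_Iio le_rfl] at h2
  have h3 := h2.trans ((measure_mono (Iio_subset_Iio hyx)).trans h1)
  exact absurd (ENNReal.lt_add_right (by finiteness) hpos.ne') (not_lt.2 h3)

lemma IsPermuton.measure_lower_right_pos (h : IsPermuton μ) {x y : ℝ} (hxy : x ≤ y)
    (hpos : 0 < μ (Iio x ×ˢ Ioi y)) : 0 < μ (Ioi x ×ˢ Iio y) := by
  have := h.1
  by_contra! h0
  have h0 := nonpos_iff_eq_zero.1 h0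
  have h1 : μ (Prod.snd ⁻¹' Iio y) ≤ μ (Iic x ×ˢ Iio y) := by
    calc _ ≤ μ (Iic x ×ˢ Iio y ∪ Ioi x ×ˢ Iio y) := measure_mono fun z hz =>
          (le_or_gt z.1 x).imp (fun h => ⟨h, hz⟩) (fun h => ⟨h, hz⟩)
      _ ≤ _ := (measure_union_le _ _).trans (by rw [h0, add_zero])
  have h2 : μ (Iic x ×ˢ Iio y) + μ (Iio x ×ˢ Ioi y) ≤ μ (Prod.fst ⁻¹' Iic x) := by
    rw [← measure_union _ (measurableSet_Iio.prod measurableSet_Ioi)]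
    · refine measure_mono ?_
      rintro z (hz | hz)
      · exact hz.1
      · exact (mem_Iio.1 hz.1).le
    · rw [Set.disjoint_left]
      exact fun z hz hz' => lt_asymm (show z.2 < y from hz.2) hz'.2
  rw [h.measure_snd measurableSet_Iio] at h1
  rw [h.measure_fst measurableSet_Iic, measure_Iic_eq_Iio le_rfl] at h2
  have h3 := h2.trans ((measure_mono (Iio_subset_Iio hxy)).trans h1)
  exact absurd (ENNReal.lt_add_right (by finiteness) hpos.ne') (not_lt.2 h3)

lemma IsPermuton.weakChain_support_below (h : IsPermuton μ) (ha : PermutonAvoids321 μ) :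
    IsWeakChain (μ.support ∩ {z | z.2 ≤ z.1}) := by
  have := h.1
  rintro s ⟨hs, hs'⟩ t ⟨ht, -⟩ hst
  by_contra! hts
  have ht' := ht
  rw [Measure.support_eq_forall_isOpen] at ht'
  have hpos := ht' (Ioi s.1 ×ˢ Iio s.2) ⟨hst, hts⟩ (isOpen_Ioi.prod isOpen_Iio)
  obtain ⟨r, hr, hr'⟩ :=
    exists_mem_support_of_measure_pos (h.measure_upper_left_pos hs' hpos)
  exact ha.not_descent_of_mem_support hr hs ht hr'.1 hst hts hr'.2

lemma IsPermuton.weakChain_support_above (h : IsPermuton μ) (ha : PermutonAvoids321 μ) :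
    IsWeakChain (μ.support ∩ {z | z.1 ≤ z.2}) := by
  have := h.1
  rintro s ⟨hs, -⟩ t ⟨ht, ht'⟩ hst
  by_contra! hts
  have hs' := hs
  rw [Measure.support_eq_forall_isOpen] at hs'
  have hpos := hs' (Iio t.1 ×ˢ Ioi t.2) ⟨hst, hts⟩ (isOpen_Iio.prod isOpen_Ioi)
  obtain ⟨r, hr, hr'⟩ :=
    exists_mem_support_of_measure_pos (h.measure_lower_right_pos ht' hpos)
  exact ha.not_descent_of_mem_support hs ht hr hst hr'.1 hr'.2 hts

lemma IsPermuton.map_fst_le (h : IsPermuton μ) (hρ : ρ ≤ μ) : ρ.map Prod.fst ≤ Leb01 := by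
  rw [← h.2.1]
  exact Measure.map_mono hρ measurable_fst

lemma IsPermuton.map_snd_le (h : IsPermuton μ) (hρ : ρ ≤ μ) : ρ.map Prod.snd ≤ Leb01 := by
  rw [← h.2.2]
  exact Measure.map_mono hρ measurable_snd

lemma PsiMeas_map_eq_of_add_eq (h : IsPermuton μ) (ha : PermutonAvoids321 μ) (hadd : ρ + σ = μ)
    (hρ : ∀ᵐ z ∂ρ, z.2 ≤ z.1) (hσ : ∀ᵐ z ∂σ, z.1 ≤ z.2) :
    PsiMeas (ρ.map Prod.fst) (ρ.map Prod.snd) = μ := by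
  have := h.1
  have hρμ : ρ ≤ μ := hadd ▸ Measure.le_add_right le_rfl
  have hσμ : σ ≤ μ := hadd ▸ Measure.le_add_left le_rfl
  have : IsFiniteMeasure ρ := isFiniteMeasure_of_le μ hρμ
  have : IsFiniteMeasure σ := isFiniteMeasure_of_le μ hσμ
  have e₁ : Leb01 - ρ.map Prod.fst = σ.map Prod.fst := by
    rw [← h.2.1, ← hadd, Measure.map_add _ _ measurable_fst, add_comm, Measure.add_sub_cancel]
  have e₂ : Leb01 - ρ.map Prod.snd = σ.map Prod.snd := by
    rw [← h.2.2, ← hadd, Measure.map_add _ _ measurable_snd, add_comm, Measure.add_sub_cancel]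
  have hsupp : ∀ᵐ z ∂μ, z ∈ μ.support := Measure.support_mem_ae
  rw [PsiMeas, e₁, e₂,
    ndCoupling_map_eq_of_weakChain (h.weakChain_support_below ha)
      ((hsupp.filter_mono (ae_mono hρμ)).and hρ) (h.map_fst_le hρμ) (h.map_snd_le hρμ),
    ndCoupling_map_eq_of_weakChain (h.weakChain_support_above ha)
      ((hsupp.filter_mono (ae_mono hσμ)).and hσ) (h.map_fst_le hσμ) (h.map_snd_le hσμ), hadd]

lemma IsPermuton.memD_map (h : IsPermuton μ) (hρμ : ρ ≤ μ) (hρ : ∀ᵐ z ∂ρ, z.2 ≤ z.1) :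
    MemD (ρ.map Prod.fst) (ρ.map Prod.snd) := by
  refine ⟨h.map_fst_le hρμ, h.map_snd_le hρμ, ?_, fun x => ?_⟩
  · rw [Measure.map_apply measurable_fst .univ, Measure.map_apply measurable_snd .univ]; rfl
  · rw [measure_Icc_eq_Iio (h.map_fst_le hρμ), measure_Icc_eq_Iio (h.map_snd_le hρμ),
      Measure.map_apply measurable_fst measurableSet_Iio,
      Measure.map_apply measurable_snd measurableSet_Iio]
    refine measure_mono_ae ?_
    filter_upwards [hρ] with z hz hzx
    exact lt_of_le_of_lt hz hzx

end Avoidance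

section Image

variable {π₁ π₂ : Measure ℝ}

lemma MemD.compl (h : MemD π₁ π₂) :
    Leb01 - π₁ ≤ Leb01 ∧ Leb01 - π₂ ≤ Leb01 ∧ (Leb01 - π₁) univ = (Leb01 - π₂) univ ∧
      ∀ x : ℝ, (Leb01 - π₂) (Icc 0 x) ≤ (Leb01 - π₁) (Icc 0 x) := by
  have := isFiniteMeasure_of_le_Leb01 h.1
  have := isFiniteMeasure_of_le_Leb01 h.2.1
  refine ⟨Measure.sub_le, Measure.sub_le, ?_, fun x => ?_⟩
  · rw [Measure.sub_apply .univ h.1, Measure.sub_apply .univ h.2.1, h.2.2.1]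
  · rw [Measure.sub_apply measurableSet_Icc h.1, Measure.sub_apply measurableSet_Icc h.2.1]
    exact tsub_le_tsub_left (h.2.2.2 x) _

instance : IsFiniteMeasure (PsiMeas π₁ π₂) := by unfold PsiMeas; infer_instance

lemma MemD.isPermuton_PsiMeas (h : MemD π₁ π₂) : IsPermuton (PsiMeas π₁ π₂) := by
  have := isFiniteMeasure_of_le_Leb01 h.1
  have := isFiniteMeasure_of_le_Leb01 h.2.1
  obtain ⟨c₁, c₂, c₃, -⟩ := h.compl
  have hf : (PsiMeas π₁ π₂).map Prod.fst = Leb01 := by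
    rw [PsiMeas, Measure.map_add _ _ measurable_fst, ndCoupling_map_fst h.1 h.2.1,
      ndCoupling_map_fst c₁ c₂, add_comm, Measure.sub_add_cancel_of_le h.1]
  have hs : (PsiMeas π₁ π₂).map Prod.snd = Leb01 := by
    rw [PsiMeas, Measure.map_add _ _ measurable_snd, ndCoupling_map_snd h.1 h.2.1 h.2.2.1,
      ndCoupling_map_snd c₁ c₂ c₃, add_comm, Measure.sub_add_cancel_of_le h.2.1]
  refine ⟨⟨?_⟩, hf, hs⟩
  rw [← Leb01_univ, ← hf, Measure.map_apply measurable_fst .univ, preimage_univ]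

lemma MemD.permutonAvoids321_PsiMeas (h : MemD π₁ π₂) : PermutonAvoids321 (PsiMeas π₁ π₂) := by
  obtain ⟨c₁, c₂, -, -⟩ := h.compl
  obtain ⟨A, hA, hA'⟩ := ndCoupling_ae_mem_weakChain h.1 h.2.1
  obtain ⟨B, hB, hB'⟩ := ndCoupling_ae_mem_weakChain c₁ c₂
  refine permutonAvoids321_of_weakChains hA hB (ae_add_measure_iff.2 ⟨?_, ?_⟩)
  · filter_upwards [hA'] with z hz using Or.inl hz
  · filter_upwards [hB'] with z hz using Or.inr hz

lemma restrict_lt_add_restrict_eq {ρ : Measure (ℝ × ℝ)} (hρ : ∀ᵐ z ∂ρ, z.2 ≤ z.1) :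
    ρ.restrict {z | z.2 < z.1} + ρ.restrict {z | z.1 = z.2} = ρ := by
  rw [← Measure.restrict_union _ (measurableSet_eq_fun measurable_fst measurable_snd)]
  · apply Measure.restrict_eq_self_of_ae_mem
    filter_upwards [hρ] with z hz
    exact hz.lt_or_eq.imp id Eq.symm
  · rw [Set.disjoint_left]
    exact fun z (hz : z.2 < z.1) (hz' : z.1 = z.2) => hz.ne' hz'

lemma MemD.exists_of_PsiMeas_eq {μ : Measure (ℝ × ℝ)} (h : MemD π₁ π₂) (hμ : PsiMeas π₁ π₂ = μ) :
    ∃ ν : Measure (ℝ × ℝ), ν ≤ μ.restrict {z : ℝ × ℝ | z.1 = z.2} ∧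
      π₁ = (μ.restrict {z : ℝ × ℝ | z.2 < z.1} + ν).map Prod.fst ∧
      π₂ = (μ.restrict {z : ℝ × ℝ | z.2 < z.1} + ν).map Prod.snd := by
  obtain ⟨c₁, c₂, -, c₄⟩ := h.compl
  have hA := ndCoupling_ae_snd_le_fst h.1 h.2.1 h.2.2.2
  have hB := ndCoupling_ae_fst_le_snd c₁ c₂ c₄
  have hB0 : (ndCoupling (Leb01 - π₁) (Leb01 - π₂)).restrict {z | z.2 < z.1} = 0 := by
    rw [Measure.restrict_eq_zero, measure_eq_zero_iff_ae_notMem]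
    filter_upwards [hB] with z hz
    exact not_lt.2 hz
  have hlr : μ.restrict {z | z.2 < z.1} = (ndCoupling π₁ π₂).restrict {z | z.2 < z.1} := by
    rw [← hμ, PsiMeas, Measure.restrict_add, hB0, add_zero]
  refine ⟨(ndCoupling π₁ π₂).restrict {z | z.1 = z.2},
    Measure.restrict_mono_measure (hμ ▸ Measure.le_add_right le_rfl) _, ?_, ?_⟩
  · rw [hlr, restrict_lt_add_restrict_eq hA, ndCoupling_map_fst h.1 h.2.1]
  · rw [hlr, restrict_lt_add_restrict_eq hA, ndCoupling_map_snd h.1 h.2.1 h.2.2.1]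

lemma exists_add_eq_of_le_diag {μ ν : Measure (ℝ × ℝ)} [IsFiniteMeasure μ]
    (hν : ν ≤ μ.restrict {z | z.1 = z.2}) :
    ∃ σ : Measure (ℝ × ℝ), μ.restrict {z | z.2 < z.1} + ν + σ = μ ∧
      (∀ᵐ z ∂(μ.restrict {z | z.2 < z.1} + ν), z.2 ≤ z.1) ∧ ∀ᵐ z ∂σ, z.1 ≤ z.2 := by
  have : IsFiniteMeasure ν := isFiniteMeasure_of_le _ hν
  have hd : MeasurableSet {z : ℝ × ℝ | z.1 = z.2} :=
    measurableSet_eq_fun measurable_fst measurable_snd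
  have hl : MeasurableSet {z : ℝ × ℝ | z.2 < z.1} :=
    measurableSet_lt measurable_snd measurable_fst
  have hdiag : ∀ᵐ z ∂(μ.restrict {z : ℝ × ℝ | z.1 = z.2}), z.1 = z.2 := ae_restrict_mem hd
  refine ⟨(μ.restrict {z | z.1 = z.2} - ν) + μ.restrict {z | z.2 < z.1 ∨ z.1 = z.2}ᶜ,
    ?_, ae_add_measure_iff.2 ⟨?_, ?_⟩, ae_add_measure_iff.2 ⟨?_, ?_⟩⟩
  · have hu : μ.restrict {z | z.2 < z.1} + μ.restrict {z | z.1 = z.2}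
        = μ.restrict {z | z.2 < z.1 ∨ z.1 = z.2} := by
      rw [← Measure.restrict_union _ hd]
      · rfl
      · rw [Set.disjoint_left]
        exact fun z (hz : z.2 < z.1) (hz' : z.1 = z.2) => hz.ne' hz'
    calc _ = μ.restrict {z | z.2 < z.1} + (μ.restrict {z | z.1 = z.2} - ν + ν)
          + μ.restrict {z | z.2 < z.1 ∨ z.1 = z.2}ᶜ := by
          rw [add_comm (_ - ν) ν]
          simp only [add_assoc]
      _ = μ := by
        rw [Measure.sub_add_cancel_of_le hν, hu]
        exact Measure.restrict_add_restrict_compl (hl.union hd)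
  · filter_upwards [ae_restrict_mem hl] with z hz using le_of_lt hz
  · filter_upwards [hdiag.filter_mono (ae_mono hν)] with z hz using hz.ge
  · filter_upwards [hdiag.filter_mono (ae_mono Measure.sub_le)] with z hz using hz.le
  · filter_upwards [ae_restrict_mem (hl.union hd).compl] with z hz
    exact not_lt.1 fun h => hz (Or.inl h)

end Image

section Continuity

variable {ι : Type*} {l : Filter ι}

lemma tendsto_measureReal_Iio {πs : ι → FiniteMeasure ℝ} {π : FiniteMeasure ℝ}
    (hs : ∀ i, (πs i : Measure ℝ) ≤ Leb01) (h : (π : Measure ℝ) ≤ Leb01)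
    (hlim : Tendsto πs l (𝓝 π)) (x : ℝ) :
    Tendsto (fun i => (πs i : Measure ℝ).real (Iio x)) l (𝓝 ((π : Measure ℝ).real (Iio x))) := by
  have upper : ∀ {F : Set ℝ}, IsClosed F → ∀ b, (π : Measure ℝ).real F < b →
      ∀ᶠ i in l, (πs i : Measure ℝ).real F < b := by
    intro F hF b hb
    have hb0 : 0 < b := measureReal_nonneg.trans_lt hb
    have h1 : (π : Measure ℝ) F < ENNReal.ofReal b :=
      (ENNReal.lt_ofReal_iff_toReal_lt (by finiteness)).2 hb
    filter_upwards [eventually_lt_of_limsup_lt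
      ((FiniteMeasure.limsup_measure_closed_le_of_tendsto hlim hF).trans_lt h1)] with i hi
    exact (ENNReal.lt_ofReal_iff_toReal_lt (by finiteness)).1 hi
  have hmass : Tendsto (fun i => (πs i : Measure ℝ).real univ) l
      (𝓝 ((π : Measure ℝ).real univ)) := by
    have := (NNReal.continuous_coe.comp FiniteMeasure.continuous_mass).continuousAt.tendsto.comp
      hlim
    exact this
  have hcompl : ∀ ρ : FiniteMeasure ℝ,
      (ρ : Measure ℝ).real (Iio x) = (ρ : Measure ℝ).real univ - (ρ : Measure ℝ).real (Ici x) := by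
    intro ρ
    rw [← compl_Iio, measureReal_compl measurableSet_Iio, sub_sub_cancel]
  have hIic : ∀ {ρ : Measure ℝ}, ρ ≤ Leb01 → ρ.real (Iic x) = ρ.real (Iio x) := fun hρ => by
    rw [measureReal_def, measureReal_def, measure_Iic_eq_Iio hρ]
  refine tendsto_order.2 ⟨fun a ha => ?_, fun b hb => ?_⟩
  · obtain ⟨ε, hε, hεa⟩ : ∃ ε > 0, a + 2 * ε ≤ (π : Measure ℝ).real (Iio x) :=
      ⟨((π : Measure ℝ).real (Iio x) - a) / 2, by linarith, by linarith⟩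
    filter_upwards [hmass.eventually_const_lt (sub_lt_self _ hε),
      upper isClosed_Ici _ (lt_add_of_pos_right _ hε)] with i h1 h2
    rw [hcompl] at hεa ⊢
    linarith
  · rw [← hIic h] at hb
    filter_upwards [upper isClosed_Iic b hb] with i hi
    rwa [hIic (hs i)] at hi

lemma tendsto_quantileFun {πs : ι → Measure ℝ} {π : Measure ℝ} {u : ℝ}
    (hs : ∀ i, πs i ≤ Leb01) (h : π ≤ Leb01)
    (hlim : ∀ q : ℚ, Tendsto (fun i => (πs i).real (Iio (q : ℝ))) l (𝓝 (π.real (Iio (q : ℝ)))))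
    (hu : u ∈ Ioo 0 (π univ).toReal) (hsu : ∀ᶠ i in l, u ∈ Ioo 0 (πs i univ).toReal)
    (hne : ∀ q : ℚ, u ≠ π.real (Iio (q : ℝ))) :
    Tendsto (fun i => quantileFun (πs i) u) l (𝓝 (quantileFun π u)) := by
  refine tendsto_order.2 ⟨fun a ha => ?_, fun b hb => ?_⟩
  · obtain ⟨q, haq, hq⟩ := exists_rat_btwn ha
    have h1 : π.real (Iio (q : ℝ)) < u :=
      lt_of_le_of_ne (not_lt.1 fun h' => lt_asymm hq ((quantileFun_lt_iff h hu).2 h')) (hne q).symm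
    filter_upwards [hsu, (hlim q).eventually_lt_const h1] with i hi hlt
    refine haq.trans_le (not_lt.1 fun h' => ?_)
    exact lt_asymm hlt ((quantileFun_lt_iff (hs i) hi).1 h')
  · obtain ⟨q, hq, hqb⟩ := exists_rat_btwn hb
    filter_upwards [hsu, (hlim q).eventually_const_lt ((quantileFun_lt_iff h hu).1 hq)]
      with i hi hlt
    exact ((quantileFun_lt_iff (hs i) hi).2 hlt).trans hqb

lemma integral_ndCoupling {μ ν : Measure ℝ} (hμ : μ ≤ Leb01) (hν : ν ≤ Leb01)
    (f : BoundedContinuousFunction (ℝ × ℝ) ℝ) :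
    ∫ z, f z ∂(ndCoupling μ ν) = ∫ u, (Ioo (0:ℝ) (μ univ).toReal).indicator
      (fun u => f (quantileFun μ u, quantileFun ν u)) u := by
  rw [ndCoupling, integral_map (measurable_quantilePair hμ hν).aemeasurable
    f.continuous.aestronglyMeasurable, integral_indicator measurableSet_Ioo]

lemma measureReal_univ_eq_Iio_two {π : Measure ℝ} (h : π ≤ Leb01) :
    (π univ).toReal = π.real (Iio ((2 : ℚ) : ℝ)) := by
  rw [measureReal_def, measure_Iio_eq_univ h (by norm_num)]

lemma tendsto_integral_ndCoupling [l.IsCountablyGenerated] {μs νs : ι → Measure ℝ}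
    {μ ν : Measure ℝ} (hμs : ∀ i, μs i ≤ Leb01) (hνs : ∀ i, νs i ≤ Leb01)
    (hμ : μ ≤ Leb01) (hν : ν ≤ Leb01)
    (hms : ∀ i, μs i univ = νs i univ) (hm : μ univ = ν univ)
    (hμlim : ∀ q : ℚ, Tendsto (fun i => (μs i).real (Iio (q : ℝ))) l (𝓝 (μ.real (Iio (q : ℝ)))))
    (hνlim : ∀ q : ℚ, Tendsto (fun i => (νs i).real (Iio (q : ℝ))) l (𝓝 (ν.real (Iio (q : ℝ)))))
    (f : BoundedContinuousFunction (ℝ × ℝ) ℝ) :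
    Tendsto (fun i => ∫ z, f z ∂(ndCoupling (μs i) (νs i))) l
      (𝓝 (∫ z, f z ∂(ndCoupling μ ν))) := by
  simp_rw [integral_ndCoupling (hμs _) (hνs _) f, integral_ndCoupling hμ hν f]
  have hmass : Tendsto (fun i => (μs i univ).toReal) l (𝓝 (μ univ).toReal) := by
    simp_rw [measureReal_univ_eq_Iio_two (hμs _), measureReal_univ_eq_Iio_two hμ]
    exact hμlim 2
  refine tendsto_integral_filter_of_dominated_convergence
    ((Ioo (0:ℝ) 1).indicator fun _ => ‖f‖) ?_ ?_ ?_ ?_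
  · refine Eventually.of_forall fun i => AEStronglyMeasurable.indicator ?_ measurableSet_Ioo
    exact (f.continuous.measurable.comp
      (measurable_quantilePair (hμs i) (hνs i))).aestronglyMeasurable
  · refine Eventually.of_forall fun i => ae_of_all _ fun u => ?_
    by_cases hu : u ∈ Ioo (0:ℝ) (μs i univ).toReal
    · have hle : (μs i univ).toReal ≤ 1 := by
        have := ENNReal.toReal_mono (by finiteness) (hμs i univ)
        rwa [Leb01_univ, ENNReal.toReal_one] at this
      rw [indicator_of_mem hu, indicator_of_mem (show u ∈ Ioo (0:ℝ) 1 from ⟨hu.1, hu.2.trans_le hle⟩)]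
      exact f.norm_coe_le_norm _
    · rw [indicator_of_notMem hu, norm_zero]
      exact indicator_nonneg (fun _ _ => norm_nonneg f) u
  · exact (integrable_indicator_iff measurableSet_Ioo).2 (integrableOn_const (by simp))
  · have hae : ∀ g : ℚ → ℝ, ∀ᵐ u : ℝ, ∀ q, u ≠ g q := fun g => by
      filter_upwards [(countable_range g).ae_notMem volume] with u hu q hq
      exact hu ⟨q, hq.symm⟩
    filter_upwards [hae fun q => μ.real (Iio (q : ℝ)), hae fun q => ν.real (Iio (q : ℝ)),
      hae fun _ => 0] with u hu₁ hu₂ hu₀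
    rcases lt_or_ge u 0 with hneg | hpos
    · have hout : ∀ M, u ∉ Ioo (0:ℝ) M := fun M h => lt_asymm hneg h.1
      simp only [indicator_of_notMem (hout _)]
      exact tendsto_const_nhds
    have hpos : 0 < u := lt_of_le_of_ne hpos (hu₀ 0).symm
    rcases lt_or_ge u (μ univ).toReal with hlt | hge
    · have hu : u ∈ Ioo (0:ℝ) (μ univ).toReal := ⟨hpos, hlt⟩
      have hev : ∀ᶠ i in l, u ∈ Ioo (0:ℝ) (μs i univ).toReal := by
        filter_upwards [hmass.eventually_const_lt hlt] with i hi using ⟨hpos, hi⟩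
      have hlim := (tendsto_quantileFun hμs hμ hμlim hu hev hu₁).prodMk_nhds
        (tendsto_quantileFun hνs hν hνlim (hm ▸ hu) (by simpa only [hms] using hev) hu₂)
      rw [indicator_of_mem hu]
      refine ((f.continuous.tendsto _).comp hlim).congr' ?_
      filter_upwards [hev] with i hi
      rw [indicator_of_mem hi]
      rfl
    · have hgt : (μ univ).toReal < u := by
        refine lt_of_le_of_ne hge fun h => ?_
        rw [measureReal_univ_eq_Iio_two hμ] at h
        exact hu₁ 2 h.symm
      have hout : u ∉ Ioo (0:ℝ) (μ univ).toReal := fun h => lt_asymm h.2 hgt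
      rw [indicator_of_notMem hout]
      refine tendsto_const_nhds.congr' ?_
      filter_upwards [hmass.eventually_lt_const hgt] with i hi
      rw [indicator_of_notMem fun h => lt_asymm h.2 hi]

lemma integral_PsiMeas (π₁ π₂ : Measure ℝ) (f : BoundedContinuousFunction (ℝ × ℝ) ℝ) :
    ∫ z, f z ∂(PsiMeas π₁ π₂) =
      ∫ z, f z ∂(ndCoupling π₁ π₂) + ∫ z, f z ∂(ndCoupling (Leb01 - π₁) (Leb01 - π₂)) :=
  integral_add_measure (f.integrable _) (f.integrable _)

lemma Leb01_sub_real_Iio {π : Measure ℝ} (h : π ≤ Leb01) (x : ℝ) :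
    (Leb01 - π).real (Iio x) = Leb01.real (Iio x) - π.real (Iio x) := by
  have := isFiniteMeasure_of_le_Leb01 h
  rw [measureReal_def, Measure.sub_apply measurableSet_Iio h,
    ENNReal.toReal_sub_of_le (h _) (by finiteness)]
  rfl

lemma Dspace.continuous_val :
    Continuous fun p : Dspace => (p.1 : FiniteMeasure ℝ × FiniteMeasure ℝ) :=
  continuous_subtype_val

/-- The map `Ψ` with values in finite measures. -/
def PsiMap (p : Dspace) : FiniteMeasure (ℝ × ℝ) :=
  ⟨PsiMeas (p.1.1 : Measure ℝ) (p.1.2 : Measure ℝ), inferInstance⟩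

lemma continuous_PsiMap : Continuous PsiMap := by
  let T : Dspace → (ℚ → ℝ) × (ℚ → ℝ) := fun p =>
    (fun q => (p.1.1 : Measure ℝ).real (Iio (q : ℝ)),
      fun q => (p.1.2 : Measure ℝ).real (Iio (q : ℝ)))
  rw [continuous_iff_continuousAt]
  intro p
  have hfst : Tendsto (fun r : Dspace => r.1.1) (𝓝 p) (𝓝 p.1.1) :=
    (continuous_fst.comp Dspace.continuous_val).tendsto p
  have hsnd : Tendsto (fun r : Dspace => r.1.2) (𝓝 p) (𝓝 p.1.2) :=
    (continuous_snd.comp Dspace.continuous_val).tendsto p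
  have hT : 𝓝 p ≤ comap T (𝓝 (T p)) := by
    rw [← tendsto_iff_comap]
    exact Tendsto.prodMk_nhds
      (tendsto_pi_nhds.2 fun q => tendsto_measureReal_Iio (fun r => r.2.1) p.2.1 hfst q)
      (tendsto_pi_nhds.2 fun q => tendsto_measureReal_Iio (fun r => r.2.2.1) p.2.2.1 hsnd q)
  have hlim₁ : ∀ q : ℚ, Tendsto (fun r : Dspace => (r.1.1 : Measure ℝ).real (Iio (q : ℝ)))
      (comap T (𝓝 (T p))) (𝓝 ((p.1.1 : Measure ℝ).real (Iio (q : ℝ)))) := fun q =>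
    ((continuous_apply q).comp continuous_fst).continuousAt.tendsto.comp
      (tendsto_comap (f := T) (x := 𝓝 (T p)))
  have hlim₂ : ∀ q : ℚ, Tendsto (fun r : Dspace => (r.1.2 : Measure ℝ).real (Iio (q : ℝ)))
      (comap T (𝓝 (T p))) (𝓝 ((p.1.2 : Measure ℝ).real (Iio (q : ℝ)))) := fun q =>
    ((continuous_apply q).comp continuous_snd).continuousAt.tendsto.comp
      (tendsto_comap (f := T) (x := 𝓝 (T p)))
  refine FiniteMeasure.tendsto_iff_forall_integral_tendsto.2 fun f => Tendsto.mono_left ?_ hT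
  change Tendsto (fun r : Dspace => ∫ z, f z ∂(PsiMeas r.1.1 r.1.2)) _
    (𝓝 (∫ z, f z ∂(PsiMeas p.1.1 p.1.2)))
  simp_rw [integral_PsiMeas]
  refine (tendsto_integral_ndCoupling (fun r => r.2.1) (fun r => r.2.2.1) p.2.1 p.2.2.1
    (fun r => r.2.2.2.1) p.2.2.2.1 hlim₁ hlim₂ f).add
    (tendsto_integral_ndCoupling (fun r => Measure.sub_le) (fun r => Measure.sub_le)
      Measure.sub_le Measure.sub_le (fun r => (MemD.compl r.2).2.2.1) (MemD.compl p.2).2.2.1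
      (fun q => ?_) (fun q => ?_) f)
  · rw [Leb01_sub_real_Iio p.2.1]
    exact ((hlim₁ q).const_sub _).congr fun r => (Leb01_sub_real_Iio r.2.1 _).symm
  · rw [Leb01_sub_real_Iio p.2.2.1]
    exact ((hlim₂ q).const_sub _).congr fun r => (Leb01_sub_real_Iio r.2.2.1 _).symm

end Continuity

/-- The map `Ψ : D → M([0,1]²)`, `Ψ(π₁,π₂) = π₁↗π₂ + (Leb−π₁)↗(Leb−π₂)`, is continuous
for weak convergence, its image is exactly the set of `321`-avoiding permutons, and its
fibers are `Ψ⁻¹(μ) = {proj(μ_lr + ν) : 0 ≤ ν ≤ μ_diag}`. -/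
theorem Psi_parametrizes_321_avoiding_permutons :
    ∃ Ψ : Dspace → FiniteMeasure (ℝ × ℝ),
      (∀ p : Dspace, (Ψ p : Measure (ℝ × ℝ)) = PsiMeas (p.1.1 : Measure ℝ) (p.1.2 : Measure ℝ)) ∧
      Continuous Ψ ∧
      ((Set.range fun p : Dspace => (Ψ p : Measure (ℝ × ℝ))) =
        {μ : Measure (ℝ × ℝ) | IsPermuton μ ∧ PermutonAvoids321 μ}) ∧
      (∀ μ : Measure (ℝ × ℝ), IsPermuton μ → PermutonAvoids321 μ →
        ∀ p : Dspace,
          ((Ψ p : Measure (ℝ × ℝ)) = μ ↔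
            ∃ ν : Measure (ℝ × ℝ),
              ν ≤ μ.restrict {z : ℝ × ℝ | z.1 = z.2} ∧
              (p.1.1 : Measure ℝ) =
                (μ.restrict {z : ℝ × ℝ | z.2 < z.1} + ν).map Prod.fst ∧
              (p.1.2 : Measure ℝ) =
                (μ.restrict {z : ℝ × ℝ | z.2 < z.1} + ν).map Prod.snd)) := by
  refine ⟨PsiMap, fun _ => rfl, continuous_PsiMap, ?_, ?_⟩
  · ext μ
    constructor
    · rintro ⟨p, rfl⟩
      exact ⟨MemD.isPermuton_PsiMeas p.2, MemD.permutonAvoids321_PsiMeas p.2⟩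
    · rintro ⟨h, ha⟩
      have := h.1
      obtain ⟨σ, hadd, hρ, hσ⟩ := exists_add_eq_of_le_diag (μ := μ) (Measure.zero_le _)
      have hle := hadd ▸ Measure.le_add_right (ν' := σ) le_rfl
      have hD := h.memD_map hle hρ
      refine ⟨⟨(⟨_, isFiniteMeasure_of_le_Leb01 hD.1⟩, ⟨_, isFiniteMeasure_of_le_Leb01 hD.2.1⟩),
        hD⟩, PsiMeas_map_eq_of_add_eq h ha hadd hρ hσ⟩
  · intro μ h ha p
    have := h.1
    constructor
    · exact fun hp => MemD.exists_of_PsiMeas_eq p.2 hp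
    · rintro ⟨ν, hν, h₁, h₂⟩
      obtain ⟨σ, hadd, hρ, hσ⟩ := exists_add_eq_of_le_diag hν
      change PsiMeas (p.1.1 : Measure ℝ) (p.1.2 : Measure ℝ) = μ
      rw [h₁, h₂]
      exact PsiMeas_map_eq_of_add_eq h ha hadd hρ hσ

end
end

section
/- For each n ≥ 1, let σ_n be a uniformly random 231-avoiding permutation of {1,…,n}. Then the random excursions φ_{σ_n} satisfy a large deviation principle on E (with the supremum norm) at speed n, with rate function H^{231}(φ) := 2·∫₀¹ J(φ'(t)) dt, where φ' is the almost-everywhere derivative of the Lipschitz function φ and J(y) := ½(1+y)log(1+y) + ½(1−y)log(1−y) for y ∈ [−1,1] (with 0·log 0 = 0). -/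
open MeasureTheory Filter Set

attribute [local instance] Classical.propDecidable

noncomputable section

/-- `σ` avoids the pattern `231`. -/
def Avoids231 {n : ℕ} (σ : Equiv.Perm (Fin n)) : Prop :=
  ¬ ∃ i j k : Fin n, i < j ∧ j < k ∧ σ k < σ i ∧ σ i < σ j

/-- A sequence of set functions `p n` (probabilities of events) satisfies a large
deviation principle at speed `n` with rate function `I` (a nonnegative lower
semicontinuous function with values in `[0,∞]`). -/
def SatisfiesLDP {X : Type*} [TopologicalSpace X]
    (p : ℕ → Set X → ENNReal) (I : X → EReal) : Prop :=
  LowerSemicontinuous I ∧ (∀ x, 0 ≤ I x) ∧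
  (∀ F : Set X, IsClosed F →
    Filter.limsup (fun n : ℕ => (((n : ℝ)⁻¹ : ℝ) : EReal) * ENNReal.log (p n F))
      Filter.atTop ≤ - ⨅ x ∈ F, I x) ∧
  (∀ O : Set X, IsOpen O →
    - ⨅ x ∈ O, I x ≤
      Filter.liminf (fun n : ℕ => (((n : ℝ)⁻¹ : ℝ) : EReal) * ENNReal.log (p n O))
        Filter.atTop)

/-- An excursion: a nonnegative `1`-Lipschitz function with `φ(0) = φ(1) = 0`
(defined on `[0,1]` and extended by `0` to `ℝ`). -/
def IsExcursion (φ : BoundedContinuousFunction ℝ ℝ) : Prop :=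
  LipschitzWith 1 ⇑φ ∧ (∀ t : ℝ, 0 ≤ φ t) ∧ φ 0 = 0 ∧ φ 1 = 0 ∧
    ∀ t : ℝ, t ∉ Set.Icc (0:ℝ) 1 → φ t = 0

/-- The space `E` of excursions, equipped with the supremum norm topology. -/
def Espace : Type := {φ : BoundedContinuousFunction ℝ ℝ // IsExcursion φ}

instance : TopologicalSpace Espace := by unfold Espace; infer_instance

/-- `J(y) = ½(1+y)log(1+y) + ½(1−y)log(1−y)`. -/
def Jfun (y : ℝ) : ℝ :=
  (1 + y) * Real.log (1 + y) / 2 + (1 - y) * Real.log (1 - y) / 2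

/-- The rate function `H^{231}(φ) = 2∫₀¹ J(φ'(t)) dt`, where `φ'` is the
almost-everywhere derivative of the Lipschitz function `φ`. -/
def H231 (φ : Espace) : EReal :=
  ((2 * ∫ t in (0:ℝ)..1, Jfun (deriv (⇑φ.1) t) : ℝ) : EReal)

/-- The (non normalized) RLM curve of a `231`-avoiding permutation, as a function on
`ℝ`: `F_σ(x) = min{σ(c) : c > x} − 1` (in 1-indexed terms) for `x < n`, and `n` for
`x ≥ n`. -/
def discF {n : ℕ} (σ : Equiv.Perm (Fin n)) (u : ℝ) : ℝ :=
  if u < n then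
    sInf {v : ℝ | ∃ c : Fin n, u < (c : ℕ) + 1 ∧ v = (((σ c : Fin n) : ℕ) : ℝ)}
  else n

/-- The normalized RLM curve `f_σ(x) = F_σ(nx)/n` of a `231`-avoiding permutation. -/
def fcurve {n : ℕ} (σ : Equiv.Perm (Fin n)) (x : ℝ) : ℝ := discF σ (n * x) / n

/-- The completed graph `{(x,y) : x ∈ [0,1], g(x⁻) ≤ y ≤ g(x)}` of `g`. -/
def completedGraph (g : ℝ → ℝ) : Set (ℝ × ℝ) :=
  {p : ℝ × ℝ | p.1 ∈ Set.Icc (0:ℝ) 1 ∧ p.2 ∈ Set.Icc (Function.leftLim g p.1) (g p.1)}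

/-- The rotated-flipped-rescaled graph `{(t + φ(t), t − φ(t)) : t ∈ [0,1]}` of an
excursion `φ`. -/
def excursionGraph (φ : ℝ → ℝ) : Set (ℝ × ℝ) :=
  {q : ℝ × ℝ | ∃ t ∈ Set.Icc (0:ℝ) 1, q = (t + φ t, t - φ t)}

/-- Probability that a uniform `231`-avoiding permutation of size `n` has its excursion
in `S`. -/
def probUnif231 (phi : ∀ n : ℕ, Equiv.Perm (Fin n) → Espace) (n : ℕ)
    (S : Set Espace) : ENNReal :=
  ((Finset.univ.filter
      (fun σ : Equiv.Perm (Fin n) => Avoids231 σ ∧ phi n σ ∈ S)).card : ENNReal) /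
    ((Finset.univ.filter (fun σ : Equiv.Perm (Fin n) => Avoids231 σ)).card : ENNReal)

/-- The suffix minimum `min {σ c : c ≥ j}` of a permutation, equal to `n` for `j ≥ n`. -/
def suffixMin {n : ℕ} (σ : Equiv.Perm (Fin n)) (j : ℕ) : ℕ :=
  sInf {v : ℕ | (∃ c : Fin n, j ≤ (c : ℕ) ∧ v = (σ c : ℕ)) ∨ v = n}

lemma suffixMin_le {n : ℕ} (σ : Equiv.Perm (Fin n)) {j : ℕ} {c : Fin n} (h : j ≤ (c : ℕ)) :
    suffixMin σ j ≤ σ c :=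
  Nat.sInf_le (Or.inl ⟨c, h, rfl⟩)

lemma suffixMin_le_size {n : ℕ} (σ : Equiv.Perm (Fin n)) (j : ℕ) : suffixMin σ j ≤ n :=
  Nat.sInf_le (Or.inr rfl)

lemma suffixMin_mem {n : ℕ} (σ : Equiv.Perm (Fin n)) (j : ℕ) :
    (∃ c : Fin n, j ≤ (c : ℕ) ∧ suffixMin σ j = (σ c : ℕ)) ∨ suffixMin σ j = n :=
  Nat.sInf_mem (s := {v : ℕ | (∃ c : Fin n, j ≤ (c : ℕ) ∧ v = (σ c : ℕ)) ∨ v = n}) ⟨n, Or.inr rfl⟩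

lemma suffixMin_attained {n : ℕ} (σ : Equiv.Perm (Fin n)) {j : ℕ} (hj : j < n) :
    ∃ c : Fin n, j ≤ (c : ℕ) ∧ suffixMin σ j = (σ c : ℕ) := by
  rcases suffixMin_mem σ j with h | h
  · exact h
  · have := suffixMin_le σ (j := j) (c := ⟨j, hj⟩) le_rfl
    have := (σ ⟨j, hj⟩).2
    omega

lemma suffixMin_of_le {n : ℕ} (σ : Equiv.Perm (Fin n)) {j : ℕ} (hj : n ≤ j) :
    suffixMin σ j = n := by
  rcases suffixMin_mem σ j with ⟨c, h, -⟩ | h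
  · have := c.2
    omega
  · exact h

lemma suffixMin_mono {n : ℕ} (σ : Equiv.Perm (Fin n)) : Monotone (suffixMin σ) := by
  intro i j hij
  rcases suffixMin_mem σ j with ⟨c, h, h'⟩ | h
  · rw [h']
    exact suffixMin_le σ (hij.trans h)
  · rw [h]
    exact suffixMin_le_size σ i

lemma suffixMin_le_self {n : ℕ} (σ : Equiv.Perm (Fin n)) (j : ℕ) : suffixMin σ j ≤ j := by
  rcases le_total n j with h | h
  · exact (suffixMin_le_size σ j).trans h
  have hc : (Finset.univ.filter fun c : Fin n => j ≤ (c : ℕ)).card ≤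
      (Finset.Ico (suffixMin σ j) n).card := by
    refine Finset.card_le_card_of_injOn (fun c => (σ c : ℕ)) ?_ ?_
    · intro c hc
      simp only [Finset.coe_filter, Finset.mem_univ, true_and, mem_ofPred_eq] at hc
      simp [suffixMin_le σ hc]
    · intro a _ b _ hab
      exact σ.injective (Fin.ext hab)
  have h2 : (Finset.univ.filter fun c : Fin n => j ≤ (c : ℕ)).card = n - j := by
    rw [← Nat.card_Ico j n]
    refine Finset.card_bij (fun c _ => (c : ℕ)) ?_ ?_ ?_
    · intro c hc
      simpa using hc
    · intro a _ b _ hab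
      exact Fin.ext hab
    · intro b hb
      rw [Finset.mem_Ico] at hb
      exact ⟨⟨b, hb.2⟩, by simpa using hb.1, rfl⟩
  rw [h2, Nat.card_Ico] at hc
  have := suffixMin_le_size σ j
  omega

lemma suffixMin_zero {n : ℕ} (σ : Equiv.Perm (Fin n)) : suffixMin σ 0 = 0 :=
  Nat.le_zero.1 (suffixMin_le_self σ 0)

/-- If two permutations have the same suffix minima, the first avoids `231`, and they agree on the
positions of the values below `v`, then the first does not place `v` earlier. -/
lemma not_symm_lt_of_suffixMin_le {n : ℕ} {σ τ : Equiv.Perm (Fin n)} (hσ : Avoids231 σ)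
    (h : ∀ j, suffixMin σ j = suffixMin τ j) (v : Fin n)
    (ih : ∀ w < v, σ.symm w = τ.symm w) : ¬ σ.symm v < τ.symm v := by
  intro hlt
  set i := σ.symm v with hi
  set j := τ.symm v with hj
  have hσi : σ i = v := by simp [hi]
  have hτj : τ j = v := by simp [hj]
  have h1 : suffixMin σ j ≤ v := by
    rw [h, ← hτj]
    exact suffixMin_le τ le_rfl
  have h2 : v < σ j := by
    rcases lt_trichotomy v (σ j) with h' | h' | h'
    · exact h'
    · exact absurd (σ.injective (hσi.trans h')) hlt.ne
    · have := ih _ h'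
      rw [Equiv.symm_apply_apply, Equiv.eq_symm_apply, hτj] at this
      exact absurd this.symm h'.ne
  obtain ⟨k, hjk, hk⟩ := suffixMin_attained σ j.2
  have hkv : σ k ≤ v := by
    rw [Fin.le_def]
    omega
  have hjk' : j < k := by
    refine lt_of_le_of_ne (Fin.le_def.2 hjk) ?_
    rintro hjk'
    rw [← hjk'] at hkv
    exact absurd h2 (not_lt.2 hkv)
  have hkv' : σ k < v := by
    refine lt_of_le_of_ne hkv fun h' => ?_
    rw [← hσi] at h'
    exact absurd (σ.injective h') (hlt.trans hjk').ne'
  exact hσ ⟨i, j, k, hlt, hjk', by rw [hσi]; exact hkv', by rw [hσi]; exact h2⟩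

/-- A `231`-avoiding permutation is determined by its suffix minima. -/
lemma Avoids231.ext_suffixMin {n : ℕ} {σ τ : Equiv.Perm (Fin n)} (hσ : Avoids231 σ)
    (hτ : Avoids231 τ) (h : ∀ j, suffixMin σ j = suffixMin τ j) : σ = τ := by
  have key : ∀ v : Fin n, σ.symm v = τ.symm v := by
    intro v
    induction v using WellFoundedLT.induction with
    | ind v ih =>
      refine le_antisymm (not_lt.1 ?_) (not_lt.1 ?_)
      · exact not_symm_lt_of_suffixMin_le hτ (fun j => (h j).symm) v fun w hw => (ih w hw).symm
      · exact not_symm_lt_of_suffixMin_le hσ h v ih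
  have : σ.symm = τ.symm := Equiv.ext key
  simpa using congrArg Equiv.symm this

lemma suffixMin_eq_of {n : ℕ} (σ : Equiv.Perm (Fin n)) (j m : ℕ)
    (hle : ∀ c : Fin n, j ≤ (c : ℕ) → m ≤ σ c) (hex : ∃ c : Fin n, j ≤ (c : ℕ) ∧ (σ c : ℕ) = m) :
    suffixMin σ j = m := by
  obtain ⟨c, hc, hcm⟩ := hex
  refine le_antisymm (hcm ▸ suffixMin_le σ hc) ?_
  obtain ⟨d, hd, h⟩ := suffixMin_attained σ (hc.trans_lt c.2)
  rw [h]
  exact hle d hd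

/-- Insert the value `0` at position `p` of a permutation, raising all other values by one. -/
def insertZero {n : ℕ} (p : Fin (n + 1)) (σ : Equiv.Perm (Fin n)) : Equiv.Perm (Fin (n + 1)) :=
  (finSuccEquiv' p).trans ((Equiv.optionCongr σ).trans (finSuccEquiv' 0).symm)

lemma insertZero_self {n : ℕ} (p : Fin (n + 1)) (σ : Equiv.Perm (Fin n)) :
    insertZero p σ p = 0 := by
  simp [insertZero]

lemma insertZero_succAbove {n : ℕ} (p : Fin (n + 1)) (σ : Equiv.Perm (Fin n)) (i : Fin n) :
    insertZero p σ (p.succAbove i) = (σ i).succ := by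
  simp [insertZero]

/-- Every nondecreasing sequence below the diagonal is the suffix minimum sequence of a
`231`-avoiding permutation. -/
lemma exists_avoids231_suffixMin (n : ℕ) (G : ℕ → ℕ) (hmono : Monotone G) (hle : ∀ j, G j ≤ j) :
    ∃ σ : Equiv.Perm (Fin n), Avoids231 σ ∧ ∀ j < n, suffixMin σ j = G j := by
  induction n generalizing G with
  | zero => exact ⟨1, fun ⟨i, _⟩ => i.elim0, fun j hj => absurd hj (Nat.not_lt_zero j)⟩
  | succ n ih =>
    obtain ⟨p, hpn, hp0, hp1⟩ : ∃ p ≤ n, G p = 0 ∧ ∀ j ≤ n, p < j → 0 < G j := by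
      have h0 : G 0 = 0 := Nat.le_zero.1 (hle 0)
      refine ⟨Nat.findGreatest (fun j => G j = 0) n, Nat.findGreatest_le n, ?_, ?_⟩
      · exact Nat.findGreatest_spec (P := fun j => G j = 0) (Nat.zero_le n) h0
      · intro j hj hpj
        exact Nat.pos_of_ne_zero
          (Nat.findGreatest_is_greatest (P := fun j => G j = 0) hpj hj)
    obtain ⟨σ, hσ, hG⟩ := ih (fun j => if j < p then 0 else G (j + 1) - 1)
      (by
        intro a b hab
        have := hmono (Nat.succ_le_succ hab)
        simp only [Nat.succ_eq_add_one] at this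
        dsimp only
        split_ifs <;> omega)
      (by
        intro j
        have := hle (j + 1)
        split_ifs <;> omega)
    have hdec : ∀ i j : Fin n, i < j → (j : ℕ) < p → σ j < σ i := by
      intro i j hij hjp
      by_contra hcon
      have hlt : σ i < σ j := lt_of_le_of_ne (not_lt.1 hcon) fun h => hij.ne (σ.injective h)
      have h1 := hG (p - 1) (by omega)
      rw [if_pos (by omega)] at h1
      obtain ⟨k, hk, hk0⟩ := suffixMin_attained σ (j := p - 1) (by omega)
      rw [h1] at hk0
      have hlt' := Fin.lt_def.1 hlt
      have hij' := Fin.lt_def.1 hij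
      have hjk : j ≠ k := by
        rintro rfl
        omega
      have hik : i ≠ k := by
        rintro rfl
        omega
      have hik' : (σ i : ℕ) ≠ σ k := fun h => hik (σ.injective (Fin.ext h))
      refine hσ ⟨i, j, k, hij, ?_, ?_, hlt⟩
      · refine lt_of_le_of_ne (Fin.le_def.2 ?_) hjk
        omega
      · rw [Fin.lt_def]
        omega
    set q : Fin (n + 1) := ⟨p, by omega⟩ with hq
    have hsa : ∀ i : Fin n, (q.succAbove i : ℕ) = if (i : ℕ) < p then (i : ℕ) else i + 1 := by
      intro i
      simp only [Fin.succAbove, Fin.lt_def, hq]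
      split_ifs <;> simp_all
    have hsl : ∀ i j : Fin n, q.succAbove i < q.succAbove j ↔ i < j := fun i j =>
      (Fin.strictMono_succAbove q).lt_iff_lt
    refine ⟨insertZero q σ, ?_, ?_⟩
    · rintro ⟨i, j, k, hij, hjk, hki, hij'⟩
      rcases Fin.eq_self_or_eq_succAbove q i with rfl | ⟨i, rfl⟩
      · rw [insertZero_self] at hki
        exact absurd hki (Fin.not_lt_zero _)
      rcases Fin.eq_self_or_eq_succAbove q j with rfl | ⟨j, rfl⟩
      · rw [insertZero_self] at hij'
        exact absurd hij' (Fin.not_lt_zero _)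
      rw [hsl] at hij
      rw [insertZero_succAbove, insertZero_succAbove, Fin.succ_lt_succ_iff] at hij'
      rcases Fin.eq_self_or_eq_succAbove q k with rfl | ⟨k, rfl⟩
      · refine absurd hij' (not_lt.2 (hdec i j hij ?_).le)
        rw [Fin.lt_def, hsa] at hjk
        simp only [hq] at hjk
        split_ifs at hjk <;> omega
      · rw [hsl] at hjk
        rw [insertZero_succAbove, insertZero_succAbove, Fin.succ_lt_succ_iff] at hki
        exact hσ ⟨i, j, k, hij, hjk, hki, hij'⟩
    · intro j hj
      rcases le_or_gt j p with hjp | hjp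
      · have hGj : G j = 0 := Nat.le_zero.1 (hp0 ▸ hmono hjp)
        rw [hGj]
        exact suffixMin_eq_of _ _ _ (fun _ _ => Nat.zero_le _)
          ⟨q, hjp, by rw [insertZero_self]; rfl⟩
      · have hpos := hp1 j (by omega) hjp
        have hGj := hG (j - 1) (by omega)
        rw [if_neg (by omega), Nat.sub_add_cancel (by omega)] at hGj
        refine suffixMin_eq_of _ _ _ ?_ ?_
        · intro c hc
          rcases Fin.eq_self_or_eq_succAbove q c with rfl | ⟨c, rfl⟩
          · simp only [hq] at hc
            omega
          · rw [insertZero_succAbove, Fin.val_succ]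
            rw [hsa] at hc
            have := suffixMin_le σ (j := j - 1) (c := c) (by split_ifs at hc <;> omega)
            omega
        · obtain ⟨c, hc, hc'⟩ := suffixMin_attained σ (j := j - 1) (by omega)
          refine ⟨q.succAbove c, ?_, ?_⟩
          · rw [hsa]
            split_ifs <;> omega
          · rw [insertZero_succAbove, Fin.val_succ]
            omega

/-- The number of up-steps among the first `i` steps of the path with set of up-steps `A`. -/
def upCount (A : Finset ℕ) (i : ℕ) : ℕ := (A.filter (· < i)).card

lemma upCount_succ (A : Finset ℕ) (i : ℕ) :
    upCount A (i + 1) = upCount A i + if i ∈ A then 1 else 0 := by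
  unfold upCount
  split_ifs with h
  · have : A.filter (· < i + 1) = insert i (A.filter (· < i)) := by
      ext x
      simp only [Finset.mem_filter, Finset.mem_insert]
      constructor
      · rintro ⟨h1, h2⟩
        rcases eq_or_lt_of_le (Nat.lt_succ_iff.1 h2) with h3 | h3
        · exact Or.inl h3
        · exact Or.inr ⟨h1, h3⟩
      · rintro (rfl | ⟨h1, h2⟩)
        · exact ⟨h, Nat.lt_succ_self _⟩
        · exact ⟨h1, h2.trans (Nat.lt_succ_self _)⟩
    rw [this, Finset.card_insert_of_notMem (by simp)]
  · congr 1
    ext x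
    simp only [Finset.mem_filter]
    refine ⟨fun ⟨h1, h2⟩ => ⟨h1, ?_⟩, fun ⟨h1, h2⟩ => ⟨h1, h2.trans (Nat.lt_succ_self _)⟩⟩
    refine lt_of_le_of_ne (Nat.lt_succ_iff.1 h2) ?_
    rintro rfl
    exact h h1

lemma upCount_mono (A : Finset ℕ) : Monotone (upCount A) :=
  monotone_nat_of_le_succ fun i => by rw [upCount_succ]; exact Nat.le_add_right _ _

lemma upCount_add_le (A : Finset ℕ) (i k : ℕ) : upCount A (i + k) ≤ upCount A i + k := by
  induction k with
  | zero => simp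
  | succ k ih =>
    rw [← add_assoc, upCount_succ]
    split_ifs <;> omega

lemma upCount_le_add_sub (A : Finset ℕ) {i j : ℕ} (h : i ≤ j) :
    upCount A j ≤ upCount A i + (j - i) := by
  have := upCount_add_le A i (j - i)
  rwa [Nat.add_sub_cancel' h] at this

lemma upCount_of_subset {A : Finset ℕ} {N i : ℕ} (hA : A ⊆ Finset.range N) (hi : N ≤ i) :
    upCount A i = A.card := by
  unfold upCount
  rw [Finset.filter_true_of_mem]
  intro x hx
  exact (Finset.mem_range.1 (hA hx)).trans_le hi

/-- The set of up-steps of the lattice path under the curve of `σ`. -/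
def upSet {n : ℕ} (σ : Equiv.Perm (Fin n)) : Finset ℕ :=
  (Finset.range n).image fun j => j + suffixMin σ j

lemma strictMono_add_suffixMin {n : ℕ} (σ : Equiv.Perm (Fin n)) :
    StrictMono fun j => j + suffixMin σ j :=
  fun _ _ h => Nat.add_lt_add_of_lt_of_le h (suffixMin_mono σ h.le)

lemma upSet_subset {n : ℕ} (σ : Equiv.Perm (Fin n)) : upSet σ ⊆ Finset.range (2 * n) := by
  intro x hx
  obtain ⟨j, hj, rfl⟩ := Finset.mem_image.1 hx
  rw [Finset.mem_range] at hj ⊢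
  have := suffixMin_le_size σ j
  omega

lemma Avoids231.ext_upSet {n : ℕ} {σ τ : Equiv.Perm (Fin n)} (hσ : Avoids231 σ)
    (hτ : Avoids231 τ) (h : upSet σ = upSet τ) : σ = τ := by
  have hr : ∀ ρ : Equiv.Perm (Fin n), range (fun j => j + suffixMin ρ j) =
      ↑(upSet ρ) ∪ Ici (2 * n) := by
    intro ρ
    ext x
    simp only [mem_range, mem_union, Finset.mem_coe, upSet, Finset.mem_image, Finset.mem_range,
      mem_Ici]
    constructor
    · rintro ⟨j, rfl⟩
      rcases lt_or_ge j n with hj | hj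
      · exact Or.inl ⟨j, hj, rfl⟩
      · right
        rw [suffixMin_of_le ρ hj]
        omega
    · rintro (⟨j, -, rfl⟩ | hx)
      · exact ⟨j, rfl⟩
      · refine ⟨x - n, ?_⟩
        rw [suffixMin_of_le ρ (by omega)]
        omega
  have := (strictMono_add_suffixMin σ).range_inj (strictMono_add_suffixMin τ)
  rw [hr, hr, h] at this
  have h2 := this.1 rfl
  exact hσ.ext_suffixMin hτ fun j => Nat.add_left_cancel (congrFun h2 j)

/-- Every Dyck path comes from a `231`-avoiding permutation. -/
lemma exists_avoids231_upSet {n : ℕ} {A : Finset ℕ} (hA : A ⊆ Finset.range (2 * n))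
    (hcard : A.card = n) (hdyck : ∀ i ≤ 2 * n, i ≤ 2 * upCount A i) :
    ∃ σ : Equiv.Perm (Fin n), Avoids231 σ ∧ upSet σ = A := by
  set p : ℕ → Prop := fun x => x ∈ A ∨ 2 * n ≤ x with hp
  have hinf : {x | p x}.Infinite :=
    (Set.Ici_infinite (2 * n)).mono fun x hx => Or.inr hx
  set a := Nat.nth p with ha
  have hmono : StrictMono a := Nat.nth_strictMono hinf
  have hcount : ∀ i ≤ 2 * n, Nat.count p i = upCount A i := by
    intro i hi
    rw [Nat.count_eq_card_filter_range, upCount]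
    congr 1
    ext x
    simp only [Finset.mem_filter, Finset.mem_range, hp]
    constructor
    · rintro ⟨h1, h2 | h2⟩
      · exact ⟨h2, h1⟩
      · omega
    · exact fun ⟨h1, h2⟩ => ⟨h2, Or.inl h1⟩
  have hlt : ∀ j < n, a j < 2 * n := by
    intro j hj
    refine Nat.nth_lt_of_lt_count ?_
    rwa [hcount _ le_rfl, upCount_of_subset hA le_rfl, hcard]
  have hle : ∀ j < n, a j ≤ 2 * j := by
    intro j hj
    have h1 := hdyck _ (hlt j hj).le
    rwa [← hcount _ (hlt j hj).le, Nat.count_nth_of_infinite hinf] at h1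
  obtain ⟨σ, hσ, hG⟩ := exists_avoids231_suffixMin n (fun j => min (a j - j) j)
    (monotone_nat_of_le_succ fun j => by
      have := hmono (Nat.lt_succ_self j)
      simp only [Nat.succ_eq_add_one] at this
      omega)
    (fun j => min_le_right _ _)
  have hup : upSet σ = (Finset.range n).image a := by
    refine Finset.image_congr fun j hj => ?_
    rw [Finset.coe_range, mem_Iio] at hj
    have h1 := hle j hj
    have h2 : j ≤ a j := hmono.le_apply
    rw [hG j hj]
    omega
  refine ⟨σ, hσ, ?_⟩
  rw [hup]
  refine Finset.eq_of_subset_of_card_le ?_ ?_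
  · intro x hx
    obtain ⟨j, hj, rfl⟩ := Finset.mem_image.1 hx
    have h1 := hlt j (Finset.mem_range.1 hj)
    have h2 : p (a j) := Nat.nth_mem_of_infinite hinf j
    rcases h2 with h2 | h2
    · exact h2
    · omega
  · rw [Finset.card_image_of_injective _ hmono.injective, Finset.card_range, hcard]

lemma discF_eq {n : ℕ} (hn : 1 ≤ n) (σ : Equiv.Perm (Fin n)) (u : ℝ) :
    discF σ u = suffixMin σ ⌊u⌋₊ := by
  unfold discF
  split_ifs with h
  · have hlt : ⌊u⌋₊ < n := (Nat.floor_lt' (by omega)).2 h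
    have hiff : ∀ c : ℕ, u < (c : ℝ) + 1 ↔ ⌊u⌋₊ ≤ c := by
      intro c
      rw [← Nat.lt_succ_iff, Nat.floor_lt' (Nat.succ_ne_zero c), Nat.cast_succ]
    obtain ⟨c, hc, hc'⟩ := suffixMin_attained σ hlt
    refine IsLeast.csInf_eq ⟨⟨c, (hiff _).2 hc, by rw [hc']⟩, ?_⟩
    rintro v ⟨d, hd, rfl⟩
    exact_mod_cast suffixMin_le σ ((hiff _).1 hd)
  · rw [suffixMin_of_le σ (Nat.le_floor (not_lt.1 h))]

lemma fcurve_eq {n : ℕ} (hn : 1 ≤ n) (σ : Equiv.Perm (Fin n)) (x : ℝ) :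
    fcurve σ x = suffixMin σ ⌊n * x⌋₊ / n := by
  rw [fcurve, discF_eq hn]

lemma fcurve_mono {n : ℕ} (hn : 1 ≤ n) (σ : Equiv.Perm (Fin n)) : Monotone (fcurve σ) := by
  intro x y hxy
  rw [fcurve_eq hn, fcurve_eq hn]
  have : suffixMin σ ⌊n * x⌋₊ ≤ suffixMin σ ⌊n * y⌋₊ :=
    suffixMin_mono σ (Nat.floor_mono (by gcongr))
  gcongr

lemma mem_completedGraph {n : ℕ} (hn : 1 ≤ n) (σ : Equiv.Perm (Fin n)) {x y : ℕ} (hx : x ≤ n)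
    (h1 : suffixMin σ (x - 1) ≤ y) (h2 : y ≤ suffixMin σ x) :
    ((x / n : ℝ), (y / n : ℝ)) ∈ completedGraph (fcurve σ) := by
  have hn0 : (0 : ℝ) < n := by exact_mod_cast hn
  refine ⟨⟨by positivity, ?_⟩, ?_, ?_⟩
  · rw [div_le_one hn0]
    exact_mod_cast hx
  · refine le_of_tendsto ((fcurve_mono hn σ).tendsto_leftLim _) ?_
    filter_upwards [self_mem_nhdsWithin] with z hz
    rw [mem_Iio, lt_div_iff₀ hn0, mul_comm] at hz
    rw [fcurve_eq hn]
    have : ⌊n * z⌋₊ ≤ x - 1 := by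
      rcases Nat.eq_zero_or_pos x with rfl | hx0
      · rw [Nat.floor_of_nonpos]
        simpa using hz.le
      · exact Nat.le_pred_of_lt ((Nat.floor_lt' hx0.ne').2 hz)
    have := (suffixMin_mono σ this).trans h1
    gcongr
  · dsimp only
    rw [fcurve_eq hn, mul_div_cancel₀ _ hn0.ne', Nat.floor_natCast]
    gcongr

lemma upCount_upSet_spec {n : ℕ} (σ : Equiv.Perm (Fin n)) {i : ℕ} (hi : i ≤ 2 * n) :
    upCount (upSet σ) i ≤ n ∧ suffixMin σ (upCount (upSet σ) i - 1) + upCount (upSet σ) i ≤ i ∧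
      i ≤ upCount (upSet σ) i + suffixMin σ (upCount (upSet σ) i) := by
  have hex : ∃ x, i ≤ x + suffixMin σ x := ⟨n, by rw [suffixMin_of_le σ le_rfl]; omega⟩
  set x := Nat.find hex with hx
  have hxn : x ≤ n := Nat.find_le (by rw [suffixMin_of_le σ le_rfl]; omega)
  have hx1 : i ≤ x + suffixMin σ x := Nat.find_spec hex
  have hx2 : ∀ j < x, j + suffixMin σ j < i := fun j hj => not_le.1 (Nat.find_min hex hj)
  have hcnt : upCount (upSet σ) i = x := by
    rw [upCount, upSet, Finset.filter_image,
      Finset.card_image_of_injective _ (strictMono_add_suffixMin σ).injective]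
    conv_rhs => rw [← Finset.card_range x]
    congr 1
    ext j
    simp only [Finset.mem_filter, Finset.mem_range]
    constructor
    · rintro ⟨-, h⟩
      by_contra hcon
      have := (strictMono_add_suffixMin σ).monotone (not_lt.1 hcon)
      omega
    · exact fun h => ⟨h.trans_le hxn, hx2 j h⟩
  rw [hcnt]
  refine ⟨hxn, ?_, hx1⟩
  rcases Nat.eq_zero_or_pos x with h0 | h0
  · rw [h0, suffixMin_zero]
    omega
  · have := hx2 (x - 1) (by omega)
    omega

/-- The excursion of a permutation passes through the vertices of its rescaled Dyck path. -/
lemma excursion_apply_vertex {n : ℕ} (hn : 1 ≤ n) (σ : Equiv.Perm (Fin n)) {φ : ℝ → ℝ}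
    (h : completedGraph (fcurve σ) = excursionGraph φ) {i : ℕ} (hi : i ≤ 2 * n) :
    φ (i / (2 * n)) = (2 * upCount (upSet σ) i - i) / (2 * n) := by
  obtain ⟨h1, h2, h3⟩ := upCount_upSet_spec σ hi
  set x := upCount (upSet σ) i
  have hn0 : (0 : ℝ) < n := by exact_mod_cast hn
  have hmem := mem_completedGraph hn σ (x := x) (y := i - x) h1 (by omega) (by omega)
  rw [h] at hmem
  obtain ⟨t, -, ht⟩ := hmem
  rw [Prod.mk.injEq, Nat.cast_sub (by omega)] at ht
  obtain ⟨e1, e2⟩ := ht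
  have e3 : t = i / (2 * n) := by
    field_simp at e1 e2 ⊢
    linarith
  rw [← e3]
  rw [e3] at e1
  rw [e3]
  field_simp at e1 e2 ⊢
  linarith

lemma continuous_Jfun : Continuous Jfun := by
  unfold Jfun
  have h := Real.continuous_mul_log
  exact ((h.comp (continuous_const.add continuous_id)).div_const 2).add
    ((h.comp (continuous_const.sub continuous_id)).div_const 2)

lemma convexOn_Jfun : ConvexOn ℝ (Icc (-1) 1) Jfun := by
  refine ⟨convex_Icc _ _, ?_⟩
  intro x hx y hy a b ha hb hab
  have h := Real.convexOn_mul_log.2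
  have h1 := h (x := 1 + x) (y := 1 + y) (by simp only [mem_Ici]; linarith [hx.1])
    (by simp only [mem_Ici]; linarith [hy.1]) ha hb hab
  have h2 := h (x := 1 - x) (y := 1 - y) (by simp only [mem_Ici]; linarith [hx.2])
    (by simp only [mem_Ici]; linarith [hy.2]) ha hb hab
  simp only [smul_eq_mul] at h1 h2 ⊢
  have e1 : a * (1 + x) + b * (1 + y) = 1 + (a * x + b * y) := by linear_combination hab
  have e2 : a * (1 - x) + b * (1 - y) = 1 - (a * x + b * y) := by linear_combination hab
  rw [e1] at h1
  rw [e2] at h2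
  unfold Jfun
  linarith

lemma Jfun_neg (y : ℝ) : Jfun (-y) = Jfun y := by
  unfold Jfun
  rw [sub_neg_eq_add, ← sub_eq_add_neg]
  ring

lemma Jfun_zero : Jfun 0 = 0 := by simp [Jfun]

lemma Jfun_nonneg {y : ℝ} (hy : y ∈ Icc (-1 : ℝ) 1) : 0 ≤ Jfun y := by
  have hy' : -y ∈ Icc (-1 : ℝ) 1 := ⟨by linarith [hy.2], by linarith [hy.1]⟩
  have h := convexOn_Jfun.2 hy hy' (by norm_num : (0 : ℝ) ≤ 1 / 2) (by norm_num : (0 : ℝ) ≤ 1 / 2)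
    (by norm_num)
  have e : (1 / 2 : ℝ) • y + (1 / 2 : ℝ) • (-y) = 0 := by simp only [smul_eq_mul]; ring
  rw [e, Jfun_zero, Jfun_neg] at h
  simp only [smul_eq_mul] at h
  linarith

lemma deriv_mem_Icc {f : ℝ → ℝ} (hf : LipschitzWith 1 f) (t : ℝ) :
    deriv f t ∈ Icc (-1 : ℝ) 1 := by
  have := norm_deriv_le_of_lipschitz hf (x₀ := t)
  rw [Real.norm_eq_abs, NNReal.coe_one, abs_le] at this
  exact this

lemma exists_abs_Jfun_le : ∃ C : ℝ, ∀ y ∈ Icc (-1 : ℝ) 1, ‖Jfun y‖ ≤ C :=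
  isCompact_Icc.exists_bound_of_continuousOn continuous_Jfun.continuousOn

lemma intervalIntegrable_Jfun_deriv {f : ℝ → ℝ} (hf : LipschitzWith 1 f) (a b : ℝ) :
    IntervalIntegrable (fun t => Jfun (deriv f t)) volume a b := by
  obtain ⟨C, hC⟩ := exists_abs_Jfun_le
  refine (intervalIntegrable_const (c := C)).mono_fun
    (continuous_Jfun.measurable.comp (measurable_deriv f)).aestronglyMeasurable ?_
  refine Eventually.of_forall fun t => ?_
  exact (hC _ (deriv_mem_Icc hf t)).trans (le_abs_self C)

lemma LipschitzWith.intervalIntegral_deriv {f : ℝ → ℝ} (hf : LipschitzWith 1 f) (a b : ℝ) :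
    ∫ t in a..b, deriv f t = f b - f a :=
  hf.lipschitzOnWith.absolutelyContinuousOnInterval.integral_deriv_eq_sub

/-- The difference quotient of `f` over the `k`-th cell of the grid of mesh `1 / K`. -/
def cellSlope (f : ℝ → ℝ) (K k : ℕ) : ℝ := K * (f ((k + 1 : ℕ) / K) - f (k / K))

lemma abs_sub_le_of_lipschitz {f : ℝ → ℝ} (hf : LipschitzWith 1 f) (a b : ℝ) :
    |f a - f b| ≤ |a - b| := by
  have := hf.dist_le_mul a b
  rwa [Real.dist_eq, Real.dist_eq, NNReal.coe_one, one_mul] at this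

lemma cellSlope_mem {f : ℝ → ℝ} (hf : LipschitzWith 1 f) {K : ℕ} (hK : 1 ≤ K) (k : ℕ) :
    cellSlope f K k ∈ Icc (-1 : ℝ) 1 := by
  have hK0 : (0 : ℝ) < K := by exact_mod_cast hK
  have h := abs_sub_le_of_lipschitz hf ((k + 1 : ℕ) / K) (k / K)
  have e : (((k + 1 : ℕ) : ℝ) / K - k / K) = 1 / K := by push_cast; ring
  rw [e, abs_of_pos (by positivity : (0 : ℝ) < 1 / K)] at h
  rw [mem_Icc, ← abs_le, cellSlope, abs_mul, abs_of_pos hK0]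
  calc (K : ℝ) * |f ((k + 1 : ℕ) / K) - f (k / K)| ≤ K * (1 / K) := by gcongr
    _ = 1 := by field_simp

lemma Jfun_cellSlope_le {f : ℝ → ℝ} (hf : LipschitzWith 1 f) {K : ℕ} (hK : 1 ≤ K) (k : ℕ) :
    Jfun (cellSlope f K k) / K ≤
      ∫ t in (k / K : ℝ)..((k + 1 : ℕ) / K : ℝ), Jfun (deriv f t) := by
  have hK0 : (0 : ℝ) < K := by exact_mod_cast hK
  set a : ℝ := k / K with ha
  set b : ℝ := (k + 1 : ℕ) / K with hb
  have e : b - a = 1 / K := by rw [ha, hb]; push_cast; ring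
  have hab : a < b := by
    have : 0 < 1 / (K : ℝ) := by positivity
    linarith
  have h1 : IntervalIntegrable (deriv f) volume a b :=
    hf.lipschitzOnWith.absolutelyContinuousOnInterval.intervalIntegrable_deriv
  have h2 := intervalIntegrable_Jfun_deriv hf a b
  rw [intervalIntegrable_iff] at h1 h2
  have h3 := convexOn_Jfun.map_set_average_le (μ := volume) (t := uIoc a b)
    continuous_Jfun.continuousOn isClosed_Icc (by simp [uIoc_of_le hab.le, hab])
    (by simp [uIoc_of_le hab.le])
    (Eventually.of_forall fun t => deriv_mem_Icc hf t) h1 h2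
  rw [interval_average_eq_div, interval_average_eq_div, hf.intervalIntegral_deriv, e] at h3
  have e2 : (f b - f a) / (1 / K) = cellSlope f K k := by
    rw [cellSlope, ← ha, ← hb]
    field_simp
  rw [e2, le_div_iff₀ (by positivity)] at h3
  linarith [show Jfun (cellSlope f K k) * (1 / K) = Jfun (cellSlope f K k) / K by ring]

/-- The discretization of the rate function on the grid of mesh `1 / K`. -/
def gridRate (K : ℕ) (f : ℝ → ℝ) : ℝ := 2 * ∑ k ∈ Finset.range K, Jfun (cellSlope f K k) / K

lemma sum_cell_integrals {g : ℝ → ℝ} {K : ℕ} (hK : 1 ≤ K)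
    (hg : ∀ k < K, IntervalIntegrable g volume (k / K : ℝ) ((k + 1 : ℕ) / K : ℝ)) :
    ∑ k ∈ Finset.range K, ∫ t in (k / K : ℝ)..((k + 1 : ℕ) / K : ℝ), g t =
      ∫ t in (0 : ℝ)..1, g t := by
  have hK0 : (K : ℝ) ≠ 0 := by
    have : K ≠ 0 := by omega
    exact_mod_cast this
  rw [intervalIntegral.sum_integral_adjacent_intervals (a := fun k : ℕ => (k / K : ℝ)) hg]
  simp [div_self hK0]

lemma gridRate_le {f : ℝ → ℝ} (hf : LipschitzWith 1 f) {K : ℕ} (hK : 1 ≤ K) :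
    gridRate K f ≤ 2 * ∫ t in (0 : ℝ)..1, Jfun (deriv f t) := by
  rw [← sum_cell_integrals hK fun k _ => intervalIntegrable_Jfun_deriv hf _ _, gridRate]
  gcongr with k
  exact Jfun_cellSlope_le hf hK k

lemma floor_eq_of_mem_cell {K k : ℕ} (hK : 1 ≤ K) {t : ℝ} (h1 : (k / K : ℝ) ≤ t)
    (h2 : t < ((k + 1 : ℕ) / K : ℝ)) : ⌊K * t⌋₊ = k := by
  have hK0 : (0 : ℝ) < K := by exact_mod_cast hK
  rw [div_le_iff₀ hK0] at h1
  rw [lt_div_iff₀ hK0] at h2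
  rw [Nat.floor_eq_iff (le_trans (by positivity) (h1.trans_eq (mul_comm _ _)))]
  push_cast at h2
  constructor <;> linarith

lemma gridRate_eq_integral (f : ℝ → ℝ) {K : ℕ} (hK : 1 ≤ K) :
    gridRate K f = 2 * ∫ t in (0 : ℝ)..1, Jfun (cellSlope f K ⌊K * t⌋₊) := by
  have hK0 : (0 : ℝ) < K := by exact_mod_cast hK
  have hlt : ∀ k : ℕ, (k / K : ℝ) ≤ ((k + 1 : ℕ) / K : ℝ) := fun k => by
    gcongr
    omega
  have hev : ∀ k : ℕ, ∀ᵐ t : ℝ, t ∈ uIoc (k / K : ℝ) ((k + 1 : ℕ) / K : ℝ) →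
      Jfun (cellSlope f K k) = Jfun (cellSlope f K ⌊K * t⌋₊) := by
    intro k
    have : ∀ᵐ t : ℝ, t ≠ ((k + 1 : ℕ) / K : ℝ) := by simp [ae_iff]
    filter_upwards [this] with t ht hmem
    rw [uIoc_of_le (hlt k)] at hmem
    rw [floor_eq_of_mem_cell hK hmem.1.le (lt_of_le_of_ne hmem.2 ht)]
  rw [← sum_cell_integrals hK, gridRate]
  · congr 1
    refine Finset.sum_congr rfl fun k _ => ?_
    rw [← intervalIntegral.integral_congr_ae (hev k), intervalIntegral.integral_const]
    rw [smul_eq_mul]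
    push_cast
    ring
  · intro k _
    refine (intervalIntegrable_const (c := Jfun (cellSlope f K k))).congr_ae ?_
    rw [EventuallyEq, ae_restrict_iff' measurableSet_uIoc]
    exact hev k

lemma tendsto_cellSlope {f : ℝ → ℝ} {t : ℝ} (ht : 0 ≤ t) (hd : DifferentiableAt ℝ f t) :
    Tendsto (fun K : ℕ => cellSlope f K ⌊K * t⌋₊) atTop (nhds (deriv f t)) := by
  have h := hd.hasDerivAt.isLittleO
  rw [Metric.tendsto_atTop]
  intro ε hε
  have h1 := h.def (half_pos hε)
  rw [Metric.eventually_nhds_iff] at h1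
  obtain ⟨δ, hδ, h1⟩ := h1
  obtain ⟨N, hN⟩ := exists_nat_gt (1 / δ)
  refine ⟨N + 1, fun K hK => ?_⟩
  have hK0 : (0 : ℝ) < K := by
    have : 0 < K := by omega
    exact_mod_cast this
  have hKδ : 1 / (K : ℝ) < δ := by
    rw [div_lt_comm₀ hK0 hδ]
    refine hN.trans_le ?_
    exact_mod_cast (Nat.le_succ N).trans hK
  set m := ⌊K * t⌋₊ with hm
  have hm1 : (m : ℝ) ≤ K * t := Nat.floor_le (by positivity)
  have hm2 : K * t < m + 1 := Nat.lt_floor_add_one _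
  set a : ℝ := m / K with ha
  set b : ℝ := (m + 1 : ℕ) / K with hb
  have hba : b - a = 1 / K := by rw [ha, hb]; push_cast; ring
  have hat : a ≤ t := by rw [ha, div_le_iff₀ hK0]; linarith
  have htb : t ≤ b := by rw [hb, le_div_iff₀ hK0]; push_cast; linarith
  have ea := h1 (y := a) (by rw [Real.dist_eq, abs_lt]; constructor <;> linarith)
  have eb := h1 (y := b) (by rw [Real.dist_eq, abs_lt]; constructor <;> linarith)
  rw [Real.norm_eq_abs, Real.norm_eq_abs, smul_eq_mul, abs_of_nonpos (by linarith : a - t ≤ 0)] at ea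
  rw [Real.norm_eq_abs, Real.norm_eq_abs, smul_eq_mul, abs_of_nonneg (by linarith : 0 ≤ b - t)] at eb
  have key : |f b - f a - (1 / K) * deriv f t| ≤ ε / 2 * (1 / K) := by
    rw [abs_le] at ea eb ⊢
    rw [← hba]
    constructor <;> nlinarith [ea.1, ea.2, eb.1, eb.2]
  rw [Real.dist_eq]
  have e : cellSlope f K m - deriv f t = K * (f b - f a - (1 / K) * deriv f t) := by
    rw [cellSlope, ← ha, ← hb]
    field_simp
  rw [e, abs_mul, abs_of_pos hK0]
  calc (K : ℝ) * |f b - f a - (1 / K) * deriv f t| ≤ K * (ε / 2 * (1 / K)) := by gcongr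
    _ = ε / 2 := by field_simp
    _ < ε := half_lt_self hε

lemma tendsto_gridRate {f : ℝ → ℝ} (hf : LipschitzWith 1 f) :
    Tendsto (fun K : ℕ => gridRate K f) atTop
      (nhds (2 * ∫ t in (0 : ℝ)..1, Jfun (deriv f t))) := by
  obtain ⟨C, hC⟩ := exists_abs_Jfun_le
  have hev : ∀ᶠ K : ℕ in atTop,
      2 * ∫ t in (0 : ℝ)..1, Jfun (cellSlope f K ⌊K * t⌋₊) = gridRate K f := by
    filter_upwards [eventually_ge_atTop 1] with K hK
    rw [gridRate_eq_integral f hK]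
  refine Tendsto.congr' hev (Tendsto.const_mul 2 ?_)
  refine intervalIntegral.tendsto_integral_filter_of_dominated_convergence (fun _ => C) ?_ ?_
    intervalIntegrable_const ?_
  · refine Eventually.of_forall fun K => Measurable.aestronglyMeasurable ?_
    refine continuous_Jfun.measurable.comp ?_
    exact (measurable_from_nat (f := cellSlope f K)).comp
      (Nat.measurable_floor.comp (measurable_const.mul measurable_id))
  · filter_upwards [eventually_ge_atTop 1] with K hK
    exact Eventually.of_forall fun t _ => hC _ (cellSlope_mem hf hK _)
  · filter_upwards [hf.ae_differentiableAt_real] with t ht hmem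
    rw [uIoc_of_le zero_le_one] at hmem
    exact (continuous_Jfun.tendsto _).comp (tendsto_cellSlope hmem.1.le ht)

lemma Espace.lipschitz (φ : Espace) : LipschitzWith 1 ⇑φ.1 := φ.2.1

lemma continuous_eval_Espace (t : ℝ) : Continuous fun φ : Espace => φ.1 t :=
  ((BoundedContinuousFunction.lipschitz_eval_const t).continuous).comp continuous_subtype_val

lemma continuous_cellSlope (K k : ℕ) : Continuous fun φ : Espace => cellSlope φ.1 K k :=
  continuous_const.mul ((continuous_eval_Espace _).sub (continuous_eval_Espace _))

lemma continuous_gridRate (K : ℕ) : Continuous fun φ : Espace => gridRate K φ.1 :=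
  continuous_const.mul (continuous_finsetSum _ fun k _ =>
    (continuous_Jfun.comp (continuous_cellSlope K k)).div_const _)

/-- The real value of the rate function. -/
def realRate (φ : Espace) : ℝ := 2 * ∫ t in (0 : ℝ)..1, Jfun (deriv (⇑φ.1) t)

lemma H231_eq (φ : Espace) : H231 φ = (realRate φ : EReal) := rfl

lemma exists_gridRate_gt {φ : Espace} {a : ℝ} (h : a < realRate φ) :
    ∃ K : ℕ, 1 ≤ K ∧ a < gridRate K φ.1 := by
  have h1 := (tendsto_gridRate φ.lipschitz).eventually_const_lt h
  obtain ⟨K, h2, h3⟩ := (h1.and (eventually_ge_atTop 1)).exists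
  exact ⟨K, h3, h2⟩

lemma realRate_nonneg (φ : Espace) : 0 ≤ realRate φ := by
  refine mul_nonneg zero_le_two (intervalIntegral.integral_nonneg zero_le_one fun t _ => ?_)
  exact Jfun_nonneg (deriv_mem_Icc φ.lipschitz t)

lemma lowerSemicontinuous_H231 : LowerSemicontinuous H231 := by
  have key : LowerSemicontinuous realRate := by
    intro φ a ha
    obtain ⟨K, hK, h⟩ := exists_gridRate_gt ha
    filter_upwards [(continuous_gridRate K).continuousAt.eventually_const_lt h] with ψ hψ
    exact hψ.trans_le (gridRate_le ψ.lipschitz hK)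
  exact continuous_coe_real_ereal.comp_lowerSemicontinuous key EReal.coe_strictMono.monotone

/-- The excursions in `E`, seen as functions on `[0, 1]`. -/
def excursionsOnUnit : Set (BoundedContinuousFunction (Icc (0 : ℝ) 1) ℝ) :=
  {f | LipschitzWith 1 ⇑f ∧ (∀ t, 0 ≤ f t) ∧ f ⟨0, by simp⟩ = 0 ∧ f ⟨1, by simp⟩ = 0}

lemma isCompact_excursionsOnUnit : IsCompact excursionsOnUnit := by
  refine BoundedContinuousFunction.arzela_ascoli₂ (Icc (-1 : ℝ) 1) isCompact_Icc _ ?_ ?_ ?_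
  · have hev := fun t : Icc (0 : ℝ) 1 =>
      (BoundedContinuousFunction.lipschitz_eval_const (β := ℝ) t).continuous
    have h1 : IsClosed {f : BoundedContinuousFunction (Icc (0 : ℝ) 1) ℝ | LipschitzWith 1 ⇑f} := by
      simp only [lipschitzWith_iff_dist_le_mul, ofPred_forall]
      exact isClosed_iInter fun x => isClosed_iInter fun y =>
        isClosed_le ((hev x).dist (hev y)) continuous_const
    have h2 : IsClosed {f : BoundedContinuousFunction (Icc (0 : ℝ) 1) ℝ | ∀ t, 0 ≤ f t} := by
      simp only [ofPred_forall]
      exact isClosed_iInter fun t => isClosed_le continuous_const (hev t)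
    refine h1.inter (h2.inter (IsClosed.inter ?_ ?_))
    · exact isClosed_eq (hev _) continuous_const
    · exact isClosed_eq (hev _) continuous_const
  · rintro f x ⟨h1, -, h3, -⟩
    have := h1.dist_le_mul x ⟨0, by simp⟩
    rw [h3, Real.dist_eq, sub_zero, NNReal.coe_one, one_mul, Subtype.dist_eq, Real.dist_eq,
      sub_zero, abs_of_nonneg x.2.1] at this
    rw [mem_Icc, ← abs_le]
    exact this.trans x.2.2
  · refine (LipschitzWith.uniformEquicontinuous _ 1 fun f => f.2.1).equicontinuous

instance : CompactSpace Espace := by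
  have hset : {φ : BoundedContinuousFunction ℝ ℝ | IsExcursion φ} ⊆
      (fun f : BoundedContinuousFunction (Icc (0 : ℝ) 1) ℝ => f.compContinuous
        ⟨projIcc (0 : ℝ) 1 zero_le_one, continuous_projIcc⟩) '' excursionsOnUnit := by
    rintro φ ⟨h1, h2, h3, h4, h5⟩
    refine ⟨φ.compContinuous ⟨Subtype.val, continuous_subtype_val⟩, ⟨?_, ?_, ?_, ?_⟩, ?_⟩
    · exact (h1.comp (LipschitzWith.subtype_val _)).weaken (by simp)
    · exact fun t => h2 t
    · exact h3
    · exact h4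
    · ext t
      simp only [BoundedContinuousFunction.compContinuous_apply, ContinuousMap.coe_mk]
      by_cases ht : t ∈ Icc (0 : ℝ) 1
      · rw [projIcc_of_mem _ ht]
      · rw [h5 t ht]
        rcases lt_or_ge t 0 with h | h
        · rw [projIcc_of_le_left _ h.le, h3]
        · rw [projIcc_of_right_le _ (not_lt.1 fun h' => ht ⟨h, h'.le⟩), h4]
  have hclosed : IsClosed {φ : BoundedContinuousFunction ℝ ℝ | IsExcursion φ} := by
    have hev := fun t : ℝ =>
      (BoundedContinuousFunction.lipschitz_eval_const (β := ℝ) t).continuous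
    have h1 : IsClosed {f : BoundedContinuousFunction ℝ ℝ | LipschitzWith 1 ⇑f} := by
      simp only [lipschitzWith_iff_dist_le_mul, ofPred_forall]
      exact isClosed_iInter fun x => isClosed_iInter fun y =>
        isClosed_le ((hev x).dist (hev y)) continuous_const
    have h2 : IsClosed {f : BoundedContinuousFunction ℝ ℝ | ∀ t, 0 ≤ f t} := by
      simp only [ofPred_forall]
      exact isClosed_iInter fun t => isClosed_le continuous_const (hev t)
    have h3 : IsClosed
        {f : BoundedContinuousFunction ℝ ℝ | ∀ t, t ∉ Icc (0 : ℝ) 1 → f t = 0} := by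
      simp only [ofPred_forall]
      exact isClosed_iInter fun t => isClosed_iInter fun _ => isClosed_eq (hev _) continuous_const
    exact h1.inter (h2.inter ((isClosed_eq (hev _) continuous_const).inter
      ((isClosed_eq (hev _) continuous_const).inter h3)))
  have : IsCompact {φ : BoundedContinuousFunction ℝ ℝ | IsExcursion φ} :=
    IsCompact.of_isClosed_subset (isCompact_excursionsOnUnit.image
      (BoundedContinuousFunction.continuous_compContinuous _)) hclosed hset
  exact isCompact_iff_compactSpace.1 this

/-- The `±1` walk whose up-steps are the elements of `A`. -/
def walk (A : Finset ℕ) (i : ℕ) : ℝ := 2 * upCount A i - i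

lemma walk_succ_sub (A : Finset ℕ) (i : ℕ) :
    walk A (i + 1) - walk A i = if i ∈ A then 1 else -1 := by
  unfold walk
  rw [upCount_succ]
  split_ifs <;> push_cast <;> ring

lemma sum_exp_walk (N : ℕ) (c : ℕ → ℝ) :
    ∑ A ∈ (Finset.range N).powerset,
        Real.exp (∑ i ∈ Finset.range N, c i * (walk A (i + 1) - walk A i)) =
      2 ^ N * Real.exp (∑ i ∈ Finset.range N, Real.log (Real.cosh (c i))) := by
  have h1 : (2 : ℝ) ^ N * Real.exp (∑ i ∈ Finset.range N, Real.log (Real.cosh (c i))) =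
      ∏ i ∈ Finset.range N, (Real.exp (c i) + Real.exp (-c i)) := by
    rw [Real.exp_sum]
    conv_lhs => rw [← Finset.card_range N, ← Finset.prod_const, Finset.card_range,
      ← Finset.prod_mul_distrib]
    refine Finset.prod_congr rfl fun i _ => ?_
    rw [Real.exp_log (Real.cosh_pos _), Real.cosh_eq]
    ring
  rw [h1, Finset.prod_add]
  refine Finset.sum_congr rfl fun A hA => ?_
  rw [Finset.mem_powerset] at hA
  rw [Real.exp_sum, ← Finset.prod_sdiff hA, mul_comm]
  congr 1
  · refine Finset.prod_congr rfl fun i hi => ?_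
    rw [walk_succ_sub, if_pos hi, mul_one]
  · refine Finset.prod_congr rfl fun i hi => ?_
    rw [walk_succ_sub, if_neg (Finset.mem_sdiff.1 hi).2, mul_neg_one]

lemma sum_range_blocks (g : ℕ → ℝ) {a : ℕ → ℕ} (ha : Monotone a) (h0 : a 0 = 0) (K : ℕ) :
    ∑ i ∈ Finset.range (a K), g i =
      ∑ k ∈ Finset.range K, ∑ i ∈ Finset.Ico (a k) (a (k + 1)), g i := by
  induction K with
  | zero => simp [h0]
  | succ K ih =>
    rw [Finset.sum_range_succ, ← ih, Finset.sum_range_add_sum_Ico _ (ha K.le_succ)]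

/-- The index of the first vertex of the walk of length `2 * n` at or after time `k / K`. -/
def gridIndex (n K k : ℕ) : ℕ := ⌈(2 * n * k / K : ℝ)⌉₊

lemma gridIndex_mono (n K : ℕ) : Monotone (gridIndex n K) := by
  intro i j h
  unfold gridIndex
  gcongr

lemma le_gridIndex (n K k : ℕ) : (2 * n * k / K : ℝ) ≤ gridIndex n K k := Nat.le_ceil _

lemma gridIndex_le (n K k : ℕ) : (gridIndex n K k : ℝ) ≤ 2 * n * k / K + 1 :=
  (Nat.ceil_lt_add_one (by positivity)).le

lemma gridIndex_zero (n K : ℕ) : gridIndex n K 0 = 0 := by simp [gridIndex]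

lemma gridIndex_self (n : ℕ) {K : ℕ} (hK : 1 ≤ K) : gridIndex n K K = 2 * n := by
  have hK0 : (K : ℝ) ≠ 0 := by
    have : K ≠ 0 := by omega
    exact_mod_cast this
  unfold gridIndex
  rw [mul_div_assoc, div_self hK0, mul_one]
  exact_mod_cast Nat.ceil_natCast (R := ℝ) (2 * n)

lemma floor_of_mem_gridBlock {n K k i : ℕ} (hn : 1 ≤ n) (hK : 1 ≤ K)
    (hi : i ∈ Finset.Ico (gridIndex n K k) (gridIndex n K (k + 1))) :
    ⌊(K * i / (2 * n) : ℝ)⌋₊ = k := by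
  have hK0 : (0 : ℝ) < K := by exact_mod_cast hK
  have hn0 : (0 : ℝ) < n := by exact_mod_cast hn
  rw [Finset.mem_Ico, gridIndex, gridIndex, Nat.ceil_le, Nat.lt_ceil, div_le_iff₀ hK0,
    lt_div_iff₀ hK0] at hi
  rw [Nat.floor_eq_iff (by positivity), le_div_iff₀ (by positivity), div_lt_iff₀ (by positivity)]
  push_cast at hi
  constructor <;> linarith [hi.1, hi.2]

lemma sum_gridBlocks {n K : ℕ} (hn : 1 ≤ n) (hK : 1 ≤ K) (h : ℕ → ℕ → ℝ) :
    ∑ i ∈ Finset.range (2 * n), h ⌊(K * i / (2 * n) : ℝ)⌋₊ i =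
      ∑ k ∈ Finset.range K,
        ∑ i ∈ Finset.Ico (gridIndex n K k) (gridIndex n K (k + 1)), h k i := by
  rw [← gridIndex_self n hK, sum_range_blocks _ (gridIndex_mono n K) (gridIndex_zero n K)]
  refine Finset.sum_congr rfl fun k _ => Finset.sum_congr rfl fun i hi => ?_
  rw [floor_of_mem_gridBlock hn hK hi]

/-- The exponential tilt of an excursion with intensity `θ k` on the `k`-th cell of the grid of
mesh `1 / K`, with its normalization. -/
def tilt (K : ℕ) (θ : ℕ → ℝ) (f : ℝ → ℝ) : ℝ :=
  2 * ∑ k ∈ Finset.range K,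
    (θ k * (f ((k + 1 : ℕ) / K) - f (k / K)) - Real.log (Real.cosh (θ k)) / K)

lemma continuous_tilt (K : ℕ) (θ : ℕ → ℝ) : Continuous fun φ : Espace => tilt K θ φ.1 :=
  continuous_const.mul (continuous_finsetSum _ fun _ _ => (continuous_const.mul
    ((continuous_eval_Espace _).sub (continuous_eval_Espace _))).sub continuous_const)

lemma log_cosh_nonneg (x : ℝ) : 0 ≤ Real.log (Real.cosh x) := Real.log_nonneg (Real.one_le_cosh x)

/-- The multiplicative error made when discretizing `tilt`. -/
def tiltError (K : ℕ) (θ : ℕ → ℝ) : ℝ :=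
  ∑ k ∈ Finset.range K, (2 * |θ k| + Real.log (Real.cosh (θ k)))

lemma abs_excursion_sub_walk_le {n : ℕ} (hn : 1 ≤ n) {σ : Equiv.Perm (Fin n)} {φ : Espace}
    (h : completedGraph (fcurve σ) = excursionGraph φ.1) {K k : ℕ} (hK : 1 ≤ K) (hk : k ≤ K) :
    |2 * n * φ.1 (k / K) - walk (upSet σ) (gridIndex n K k)| ≤ 1 := by
  have hK0 : (0 : ℝ) < K := by exact_mod_cast hK
  have hn0 : (0 : ℝ) < n := by exact_mod_cast hn
  have hi : gridIndex n K k ≤ 2 * n := gridIndex_self n hK ▸ gridIndex_mono n K hk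
  have h1 := excursion_apply_vertex hn σ h hi
  have h2 : walk (upSet σ) (gridIndex n K k) = 2 * n * φ.1 (gridIndex n K k / (2 * n)) := by
    rw [h1, walk]
    field_simp
  have h3 := abs_sub_le_of_lipschitz φ.lipschitz (k / K) (gridIndex n K k / (2 * n))
  rw [h2, ← mul_sub, abs_mul, abs_of_pos (by positivity : (0 : ℝ) < 2 * n)]
  calc (2 * n : ℝ) * |φ.1 (k / K) - φ.1 (gridIndex n K k / (2 * n))|
      ≤ 2 * n * |(k / K : ℝ) - gridIndex n K k / (2 * n)| := by gcongr
    _ = |(2 * n * k / K - gridIndex n K k : ℝ)| := by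
      have e : (2 * n * k / K - gridIndex n K k : ℝ) =
          2 * n * (k / K - gridIndex n K k / (2 * n)) := by field_simp
      rw [e, abs_mul, abs_of_pos (by positivity : (0 : ℝ) < 2 * n)]
    _ ≤ 1 := by
      rw [abs_le]
      constructor <;> linarith [le_gridIndex n K k, gridIndex_le n K k]

lemma mul_tilt_le {n : ℕ} (hn : 1 ≤ n) {σ : Equiv.Perm (Fin n)} {φ : Espace}
    (h : completedGraph (fcurve σ) = excursionGraph φ.1) {K : ℕ} (hK : 1 ≤ K) (θ : ℕ → ℝ) :
    n * tilt K θ φ.1 ≤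
      ∑ i ∈ Finset.range (2 * n), θ ⌊(K * i / (2 * n) : ℝ)⌋₊ *
          (walk (upSet σ) (i + 1) - walk (upSet σ) i) -
        ∑ i ∈ Finset.range (2 * n), Real.log (Real.cosh (θ ⌊(K * i / (2 * n) : ℝ)⌋₊)) +
      tiltError K θ := by
  have hK0 : (0 : ℝ) < K := by exact_mod_cast hK
  rw [sum_gridBlocks hn hK fun k i => θ k * (walk (upSet σ) (i + 1) - walk (upSet σ) i),
    sum_gridBlocks hn hK fun k _ => Real.log (Real.cosh (θ k)), tilt, tiltError,
    ← Finset.sum_sub_distrib, ← Finset.sum_add_distrib, ← mul_assoc, Finset.mul_sum]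
  refine Finset.sum_le_sum fun k hk => ?_
  rw [Finset.mem_range] at hk
  rw [← Finset.mul_sum, Finset.sum_Ico_sub _ (gridIndex_mono n K k.le_succ), Finset.sum_const,
    Nat.card_Ico, nsmul_eq_mul, Nat.cast_sub (gridIndex_mono n K k.le_succ)]
  have h1 := abs_excursion_sub_walk_le hn h hK hk.le
  have h2 := abs_excursion_sub_walk_le hn h hK (Nat.succ_le_of_lt hk)
  set w := walk (upSet σ)
  have h3 : θ k * ((2 * n * φ.1 ((k + 1 : ℕ) / K) - w (gridIndex n K (k + 1))) -
      (2 * n * φ.1 (k / K) - w (gridIndex n K k))) ≤ |θ k| * 2 := by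
    refine (le_abs_self _).trans ?_
    rw [abs_mul]
    gcongr
    refine (abs_sub _ _).trans ?_
    linarith
  have h4 : ((gridIndex n K (k + 1) : ℝ) - gridIndex n K k) * Real.log (Real.cosh (θ k)) ≤
      (2 * n / K + 1) * Real.log (Real.cosh (θ k)) := by
    refine mul_le_mul_of_nonneg_right ?_ (log_cosh_nonneg _)
    have e1 := gridIndex_le n K (k + 1)
    have e2 := le_gridIndex n K k
    have e3 : (2 * n * (k + 1 : ℕ) / K : ℝ) = 2 * n * k / K + 2 * n / K := by push_cast; ring
    linarith
  have e : (2 * n / K + 1 : ℝ) * Real.log (Real.cosh (θ k)) =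
    2 * n * (Real.log (Real.cosh (θ k)) / K) + Real.log (Real.cosh (θ k)) := by ring
  linarith

/-- The `231`-avoiding permutations of size `n` whose excursion lies in `S`. -/
def avoiders (phi : ∀ n : ℕ, Equiv.Perm (Fin n) → Espace) (n : ℕ) (S : Set Espace) :
    Finset (Equiv.Perm (Fin n)) :=
  Finset.univ.filter fun σ => Avoids231 σ ∧ phi n σ ∈ S

lemma sum_avoiders_upSet_le (phi : ∀ n : ℕ, Equiv.Perm (Fin n) → Espace) (n : ℕ) (S : Set Espace)
    {g : Finset ℕ → ℝ} (hg : ∀ A, 0 ≤ g A) :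
    ∑ σ ∈ avoiders phi n S, g (upSet σ) ≤ ∑ A ∈ (Finset.range (2 * n)).powerset, g A := by
  rw [← Finset.sum_image (f := g) (g := upSet)]
  · refine Finset.sum_le_sum_of_subset_of_nonneg ?_ fun A _ _ => hg A
    intro A hA
    obtain ⟨σ, -, rfl⟩ := Finset.mem_image.1 hA
    exact Finset.mem_powerset.2 (upSet_subset σ)
  · intro σ hσ τ hτ hst
    exact (Finset.mem_filter.1 hσ).2.1.ext_upSet (Finset.mem_filter.1 hτ).2.1 hst

lemma card_avoiders_le (phi : ∀ n : ℕ, Equiv.Perm (Fin n) → Espace) (n : ℕ) (S : Set Espace) :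
    ((avoiders phi n S).card : ℝ) ≤ 4 ^ n := by
  have h := sum_avoiders_upSet_le phi n S (g := fun _ => 1) fun _ => zero_le_one
  simp only [Finset.sum_const, Finset.card_powerset, Finset.card_range, nsmul_eq_mul, mul_one] at h
  rw [pow_mul] at h
  norm_num at h
  exact h

lemma card_avoiders_tilt_le {phi : ∀ n : ℕ, Equiv.Perm (Fin n) → Espace}
    (hphi : ∀ n : ℕ, 1 ≤ n → ∀ σ : Equiv.Perm (Fin n), Avoids231 σ →
      completedGraph (fcurve σ) = excursionGraph ⇑(phi n σ).1)
    {n : ℕ} (hn : 1 ≤ n) {K : ℕ} (hK : 1 ≤ K) (θ : ℕ → ℝ) (a : ℝ) :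
    ((avoiders phi n {φ | a ≤ tilt K θ φ.1}).card : ℝ) ≤
      Real.exp (tiltError K θ) * Real.exp (-(n * a)) * 4 ^ n := by
  set c : ℕ → ℝ := fun i => θ ⌊(K * i / (2 * n) : ℝ)⌋₊ with hc
  set L := ∑ i ∈ Finset.range (2 * n), Real.log (Real.cosh (c i)) with hL
  set C := Real.exp (tiltError K θ - n * a - L) with hC
  calc ((avoiders phi n {φ | a ≤ tilt K θ φ.1}).card : ℝ)
      = ∑ σ ∈ avoiders phi n {φ | a ≤ tilt K θ φ.1}, 1 := by simp
    _ ≤ ∑ σ ∈ avoiders phi n {φ | a ≤ tilt K θ φ.1}, C * Real.exp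
          (∑ i ∈ Finset.range (2 * n), c i * (walk (upSet σ) (i + 1) - walk (upSet σ) i)) := by
        refine Finset.sum_le_sum fun σ hσ => ?_
        obtain ⟨-, h1, h2⟩ := Finset.mem_filter.1 hσ
        have h3 := mul_tilt_le hn (hphi n hn σ h1) hK θ
        have h4 : n * a ≤ n * tilt K θ (phi n σ).1 :=
          mul_le_mul_of_nonneg_left h2 (Nat.cast_nonneg n)
        rw [hC, ← Real.exp_add, Real.one_le_exp_iff]
        linarith
    _ ≤ ∑ A ∈ (Finset.range (2 * n)).powerset, C * Real.exp
          (∑ i ∈ Finset.range (2 * n), c i * (walk A (i + 1) - walk A i)) :=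
        sum_avoiders_upSet_le phi n _ (g := fun A => C * Real.exp
          (∑ i ∈ Finset.range (2 * n), c i * (walk A (i + 1) - walk A i))) fun A =>
          mul_nonneg (Real.exp_pos _).le (Real.exp_pos _).le
    _ = Real.exp (tiltError K θ) * Real.exp (-(n * a)) * 4 ^ n := by
        rw [← Finset.mul_sum, sum_exp_walk, ← hL, pow_mul, hC, sub_eq_add_neg, sub_eq_add_neg,
          Real.exp_add, Real.exp_add, Real.exp_neg L]
        have := (Real.exp_pos L).ne'
        field_simp
        norm_num

lemma Jfun_eq_of_lt {y : ℝ} (h1 : -1 < y) (h2 : y < 1) :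
    Jfun y = Real.artanh y * y - Real.log (Real.cosh (Real.artanh y)) := by
  have h3 : 0 < 1 - y := by linarith
  have h4 : 0 < 1 + y := by linarith
  rw [Real.cosh_artanh ⟨h1, h2⟩, Real.artanh_eq_half_log ⟨h1.le, h2.le⟩, one_div (√_), Real.log_inv,
    Real.log_sqrt (by nlinarith), Real.log_div h4.ne' h3.ne',
    show 1 - y ^ 2 = (1 + y) * (1 - y) by ring, Real.log_mul h4.ne' h3.ne', Jfun]
  ring

lemma exists_tilt_ge {y : ℝ} (hy : y ∈ Icc (-1 : ℝ) 1) {ε : ℝ} (hε : 0 < ε) :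
    ∃ θ : ℝ, Jfun y - ε < θ * y - Real.log (Real.cosh θ) := by
  have hcont : Tendsto (fun η : ℝ => Jfun ((1 - η) * y)) (nhdsWithin 0 (Ioi 0)) (nhds (Jfun y)) := by
    have : Continuous fun η : ℝ => Jfun ((1 - η) * y) := continuous_Jfun.comp (by fun_prop)
    have h := (this.tendsto 0).mono_left (nhdsWithin_le_nhds (s := Ioi 0))
    simpa using h
  obtain ⟨η, h1, h2⟩ := ((hcont.eventually_const_lt (by linarith : Jfun y - ε < Jfun y)).and
    (Ioo_mem_nhdsGT (zero_lt_one' ℝ))).exists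
  have h3 : -1 < (1 - η) * y ∧ (1 - η) * y < 1 := by
    constructor <;> nlinarith [hy.1, hy.2, h2.1, h2.2]
  refine ⟨Real.artanh ((1 - η) * y), ?_⟩
  rw [Jfun_eq_of_lt h3.1 h3.2] at h1
  have h4 : 0 ≤ η * (Real.artanh ((1 - η) * y) * y) := by
    refine mul_nonneg h2.1.le ?_
    rcases le_total 0 y with h | h
    · exact mul_nonneg (Real.artanh_nonneg (mul_nonneg (by linarith [h2.2]) h)) h
    · exact mul_nonneg_of_nonpos_of_nonpos
        (Real.artanh_nonpos (mul_nonpos_of_nonneg_of_nonpos (by linarith [h2.2]) h)) h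
  linarith

lemma exists_tilt_gt {φ : Espace} {a : ℝ} (h : a < realRate φ) :
    ∃ K : ℕ, 1 ≤ K ∧ ∃ θ : ℕ → ℝ, a < tilt K θ φ.1 := by
  obtain ⟨K, hK, h⟩ := exists_gridRate_gt h
  have hK0 : (0 : ℝ) < K := by exact_mod_cast hK
  have hε : 0 < (gridRate K φ.1 - a) / 2 := by linarith
  choose θ hθ using fun k => exists_tilt_ge (cellSlope_mem φ.lipschitz hK k) hε
  refine ⟨K, hK, θ, ?_⟩
  have h1 : ∑ k ∈ Finset.range K, (Jfun (cellSlope φ.1 K k) - (gridRate K φ.1 - a) / 2) / K <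
      ∑ k ∈ Finset.range K, (θ k * cellSlope φ.1 K k - Real.log (Real.cosh (θ k))) / K := by
    refine Finset.sum_lt_sum_of_nonempty (Finset.nonempty_range_iff.2 (by omega)) fun k _ => ?_
    have := hθ k
    gcongr
  have h2 : ∑ k ∈ Finset.range K, (Jfun (cellSlope φ.1 K k) - (gridRate K φ.1 - a) / 2) / K =
      gridRate K φ.1 / 2 - (gridRate K φ.1 - a) / 2 := by
    simp only [sub_div _ _ (K : ℝ), Finset.sum_sub_distrib, Finset.sum_const, Finset.card_range,
      nsmul_eq_mul]
    rw [mul_div_cancel₀ _ hK0.ne']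
    simp only [gridRate]
    ring
  have h3 : ∑ k ∈ Finset.range K, (θ k * cellSlope φ.1 K k - Real.log (Real.cosh (θ k))) / K =
      tilt K θ φ.1 / 2 := by
    rw [tilt, mul_div_cancel_left₀ _ two_ne_zero]
    refine Finset.sum_congr rfl fun k _ => ?_
    rw [cellSlope]
    field_simp
  linarith

lemma pow_mul_factorial_le (u k : ℕ) : u ^ k * u.factorial ≤ u ^ u * k.factorial := by
  rcases le_total u k with h | h
  · obtain ⟨m, rfl⟩ := Nat.exists_eq_add_of_le h
    have := Nat.factorial_mul_pow_sub_le_factorial h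
    rw [Nat.add_sub_cancel_left] at this
    calc u ^ (u + m) * u.factorial = u ^ u * (u.factorial * u ^ m) := by ring
      _ ≤ _ := Nat.mul_le_mul_left _ this
  · obtain ⟨m, hm⟩ := Nat.exists_eq_add_of_le h
    have h1 := Nat.factorial_mul_descFactorial (n := u) (k := m) (by omega)
    have h2 := Nat.descFactorial_le_pow u m
    have h3 : u - m = k := by omega
    rw [h3] at h1
    calc u ^ k * u.factorial = u ^ k * (k.factorial * u.descFactorial m) := by rw [h1]
      _ ≤ u ^ k * (k.factorial * u ^ m) := by gcongr
      _ = u ^ (k + m) * k.factorial := by ring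
      _ = u ^ u * k.factorial := by rw [← hm]

lemma choose_mul_pow_le (u v k : ℕ) (hk : k ≤ u + v) :
    u ^ k * v ^ (u + v - k) * (u + v).choose k ≤ u ^ u * v ^ v * (u + v).choose u := by
  have h1 := pow_mul_factorial_le u k
  have h2 := pow_mul_factorial_le v (u + v - k)
  have h3 := Nat.choose_mul_factorial_mul_factorial hk
  have h4 := Nat.choose_mul_factorial_mul_factorial (Nat.le_add_right u v)
  rw [Nat.add_sub_cancel_left] at h4
  set l := u + v - k
  have hpos : 0 < k.factorial * l.factorial * (u.factorial * v.factorial) := by positivity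
  refine Nat.le_of_mul_le_mul_right ?_ hpos
  calc u ^ k * v ^ l * (u + v).choose k * (k.factorial * l.factorial * (u.factorial * v.factorial))
      = (u ^ k * u.factorial) * (v ^ l * v.factorial) *
          ((u + v).choose k * k.factorial * l.factorial) := by ring
    _ ≤ (u ^ u * k.factorial) * (v ^ v * l.factorial) * (u + v).factorial := by
        rw [h3]
        gcongr
    _ = (u ^ u * k.factorial) * (v ^ v * l.factorial) *
          ((u + v).choose u * u.factorial * v.factorial) := by rw [h4]
    _ = _ := by ring

lemma add_pow_le_choose (u v : ℕ) :
    (u + v) ^ (u + v) ≤ (u + v + 1) * (u ^ u * v ^ v * (u + v).choose u) := by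
  rw [add_pow]
  refine (Finset.sum_le_card_nsmul _ _ _ fun k hk =>
    choose_mul_pow_le u v k (by rw [Finset.mem_range] at hk; omega)).trans_eq ?_
  rw [Finset.card_range, smul_eq_mul]

lemma exp_natCast_mul_log (u : ℕ) {x : ℝ} (hx : u ≠ 0 → 0 < x) :
    Real.exp (u * Real.log x) = x ^ u := by
  rcases eq_or_ne u 0 with rfl | h
  · simp
  · rw [Real.exp_nat_mul, Real.exp_log (hx h)]

lemma two_pow_mul_exp_le_choose {u v : ℕ} (h : 1 ≤ u + v) :
    2 ^ (u + v) * Real.exp (-((u + v : ℕ) * Jfun ((u - v) / (u + v)))) ≤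
      (u + v + 1) * (u + v).choose u := by
  have hb : (0 : ℝ) < u + v := by exact_mod_cast h
  have e1 : (1 + (u - v) / (u + v) : ℝ) = 2 * u / (u + v) := by field_simp; ring
  have e2 : (1 - (u - v) / (u + v) : ℝ) = 2 * v / (u + v) := by field_simp; ring
  have hpos : ∀ w : ℕ, w ≠ 0 → (0 : ℝ) < 2 * w / (u + v) := fun w hw => by
    have : (0 : ℝ) < w := by exact_mod_cast Nat.pos_of_ne_zero hw
    positivity
  have e3 : Real.exp ((u + v : ℕ) * Jfun ((u - v) / (u + v))) =
      (2 * u / (u + v)) ^ u * (2 * v / (u + v)) ^ v := by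
    rw [← exp_natCast_mul_log u (hpos u), ← exp_natCast_mul_log v (hpos v), ← Real.exp_add, Jfun,
      e1, e2]
    congr 1
    push_cast
    field_simp
  have hp : ∀ w : ℕ, (0 : ℝ) < (2 * w / (u + v)) ^ w := fun w => by
    rcases eq_or_ne w 0 with rfl | hw
    · simp
    · exact pow_pos (hpos w hw) w
  rw [Real.exp_neg, e3, ← div_eq_mul_inv, div_le_iff₀ (mul_pos (hp u) (hp v))]
  have h1 : ((u + v : ℝ)) ^ (u + v) ≤ (u + v + 1) * (u ^ u * v ^ v * (u + v).choose u) := by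
    exact_mod_cast add_pow_le_choose u v
  have e4 : ((u + v + 1) * (u + v).choose u * ((2 * u / (u + v)) ^ u * (2 * v / (u + v)) ^ v) : ℝ) =
      2 ^ (u + v) * ((u + v + 1) * (u ^ u * v ^ v * (u + v).choose u)) / (u + v) ^ (u + v) := by
    rw [div_pow, div_pow, mul_pow, mul_pow, pow_add, pow_add]
    field_simp
  rw [e4, le_div_iff₀ (by positivity)]
  gcongr

lemma upCount_union_of_le {A B : Finset ℕ} {N i : ℕ} (hB : ∀ x ∈ B, N ≤ x) (hi : i ≤ N) :
    upCount (A ∪ B) i = upCount A i := by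
  unfold upCount
  have h : B.filter (· < i) = ∅ :=
    Finset.filter_eq_empty_iff.2 fun x hx => not_lt.2 (hi.trans (hB x hx))
  rw [Finset.filter_union, h, Finset.union_empty]

/-- Sets with prescribed numbers of elements `d 0, d 1, …` in the successive blocks of length `b`
that follow `{0, …, u - 1}`. -/
lemma exists_family_upCount (u b : ℕ) (d : ℕ → ℕ) (r : ℕ) :
    ∃ W : Finset (Finset ℕ), W.card = ∏ j ∈ Finset.range r, b.choose (d j) ∧
      ∀ A ∈ W, A ⊆ Finset.range (u + b * r) ∧
        ∀ j ≤ r, upCount A (u + b * j) = u + ∑ i ∈ Finset.range j, d i := by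
  induction r with
  | zero =>
    refine ⟨{Finset.range u}, by simp, ?_⟩
    intro A hA
    rw [Finset.mem_singleton] at hA
    subst hA
    refine ⟨by simp, fun j hj => ?_⟩
    obtain rfl : j = 0 := by omega
    rw [upCount_of_subset (Finset.Subset.refl _) (by omega)]
    simp
  | succ r ih =>
    obtain ⟨W, hcard, hW⟩ := ih
    set I := Finset.Ico (u + b * r) (u + b * (r + 1)) with hI
    have hlow : ∀ B ∈ I.powersetCard (d r), ∀ x ∈ B, u + b * r ≤ x := fun B hB x hx =>
      (Finset.mem_Ico.1 ((Finset.mem_powersetCard.1 hB).1 hx)).1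
    have hdisj : ∀ A ∈ W, ∀ B ∈ I.powersetCard (d r), Disjoint A B := by
      intro A hA B hB
      rw [Finset.disjoint_left]
      intro x hx hx'
      have h1 := Finset.mem_range.1 ((hW A hA).1 hx)
      have h2 := hlow B hB x hx'
      omega
    refine ⟨(W ×ˢ I.powersetCard (d r)).image fun p => p.1 ∪ p.2, ?_, ?_⟩
    · rw [Finset.card_image_of_injOn, Finset.card_product, hcard, Finset.card_powersetCard, hI,
        Nat.card_Ico, Finset.prod_range_succ]
      · congr 2
        rw [Nat.mul_succ]
        omega
      · rintro ⟨A, B⟩ hp ⟨A', B'⟩ hp' h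
        obtain ⟨hA, hB⟩ := Finset.mem_product.1 (Finset.mem_coe.1 hp)
        obtain ⟨hA', hB'⟩ := Finset.mem_product.1 (Finset.mem_coe.1 hp')
        simp only at hA hB hA' hB' h
        have key : ∀ A ∈ W, ∀ B ∈ I.powersetCard (d r),
            (A ∪ B) ∩ Finset.range (u + b * r) = A := by
          intro A hA B hB
          rw [Finset.union_inter_distrib_right, Finset.inter_eq_left.2 (hW A hA).1,
            Finset.disjoint_iff_inter_eq_empty.1, Finset.union_empty]
          rw [Finset.disjoint_left]
          intro x hx hx'
          have h1 := hlow B hB x hx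
          have h2 := Finset.mem_range.1 hx'
          omega
        have hAA : A = A' := by rw [← key A hA B hB, ← key A' hA' B' hB', h]
        subst hAA
        have hBB : B = B' := by
          rw [← Finset.union_sdiff_cancel_left (hdisj A hA B hB), h,
            Finset.union_sdiff_cancel_left (hdisj A hA B' hB')]
        rw [hBB]
    · intro C hC
      obtain ⟨⟨A, B⟩, hp, rfl⟩ := Finset.mem_image.1 hC
      obtain ⟨hA, hB⟩ := Finset.mem_product.1 hp
      simp only at hA hB ⊢
      have hsub : A ∪ B ⊆ Finset.range (u + b * (r + 1)) := by
        refine Finset.union_subset ((hW A hA).1.trans ?_) ?_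
        · exact Finset.range_mono (by gcongr; omega)
        · intro x hx
          exact Finset.mem_range.2 (Finset.mem_Ico.1 ((Finset.mem_powersetCard.1 hB).1 hx)).2
      refine ⟨hsub, fun j hj => ?_⟩
      rcases Nat.lt_or_ge r j with h | h
      · obtain rfl : j = r + 1 := by omega
        rw [upCount_of_subset hsub le_rfl, Finset.card_union_of_disjoint (hdisj A hA B hB),
          (Finset.mem_powersetCard.1 hB).2, ← upCount_of_subset (hW A hA).1 le_rfl,
          (hW A hA).2 r le_rfl, Finset.sum_range_succ, add_assoc]
      · rw [upCount_union_of_le (hlow B hB) (by gcongr), (hW A hA).2 j h]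

/-- The excursion `φ`, sampled at `j / r` and rescaled to an integer height. -/
def level (f : ℝ → ℝ) (c r j : ℕ) : ℕ := ⌊c * r * f (j / r)⌋₊

lemma level_le {φ : Espace} (c r j : ℕ) : (level φ.1 c r j : ℝ) ≤ c * r * φ.1 (j / r) :=
  Nat.floor_le (mul_nonneg (by positivity) (φ.2.2.1 _))

lemma le_level {φ : Espace} (c r j : ℕ) : c * r * φ.1 (j / r) ≤ level φ.1 c r j + 1 :=
  (Nat.lt_floor_add_one _).le

lemma level_zero (φ : Espace) (c r : ℕ) : level φ.1 c r 0 = 0 := by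
  have : φ.1 0 = 0 := φ.2.2.2.1
  simp [level, this]

lemma level_self (φ : Espace) (c : ℕ) {r : ℕ} (hr : 1 ≤ r) : level φ.1 c r r = 0 := by
  have h1 : φ.1 1 = 0 := φ.2.2.2.2.1
  have hr0 : (r : ℝ) ≠ 0 := by
    have : r ≠ 0 := by omega
    exact_mod_cast this
  simp [level, div_self hr0, h1]

lemma level_le_add (φ : Espace) (c : ℕ) {r : ℕ} (hr : 1 ≤ r) (j : ℕ) :
    level φ.1 c r j ≤ level φ.1 c r (j + 1) + c ∧ level φ.1 c r (j + 1) ≤ level φ.1 c r j + c := by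
  have h := cellSlope_mem φ.lipschitz hr j
  have h0 : ∀ i : ℕ, 0 ≤ c * r * φ.1 (i / r) := fun i => mul_nonneg (by positivity) (φ.2.2.1 _)
  have e : c * r * φ.1 ((j + 1 : ℕ) / r) - c * r * φ.1 (j / r) = c * cellSlope φ.1 r j := by
    rw [cellSlope]
    ring
  have hc : (0 : ℝ) ≤ c := Nat.cast_nonneg c
  have h1 := mul_le_mul_of_nonneg_left h.1 hc
  have h2 := mul_le_mul_of_nonneg_left h.2 hc
  unfold level
  rw [← Nat.floor_add_natCast (h0 _), ← Nat.floor_add_natCast (h0 _)]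
  constructor <;> refine Nat.floor_mono ?_ <;> linarith

/-- The number of up-steps in the `j`-th block of length `2 * c`. -/
def blockUps (f : ℝ → ℝ) (c r j : ℕ) : ℕ := c + level f c r (j + 1) - level f c r j

lemma sum_blockUps (φ : Espace) (c : ℕ) {r : ℕ} (hr : 1 ≤ r) (j : ℕ) :
    ∑ i ∈ Finset.range j, blockUps φ.1 c r i = c * j + level φ.1 c r j := by
  induction j with
  | zero => simp [level_zero]
  | succ j ih =>
    have := (level_le_add φ c hr j).1
    rw [Finset.sum_range_succ, ih, blockUps, Nat.mul_succ]
    omega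

lemma choose_blockUps_ge (φ : Espace) {c : ℕ} (hc : 1 ≤ c) {r : ℕ} (hr : 1 ≤ r) (j : ℕ) :
    ∃ y ∈ Icc (-1 : ℝ) 1, |y - cellSlope φ.1 r j| ≤ 1 / c ∧
      4 ^ c * Real.exp (-(2 * c * Jfun y)) ≤
        (2 * c + 1) * ((2 * c).choose (blockUps φ.1 c r j) : ℝ) := by
  have hc0 : (0 : ℝ) < c := by exact_mod_cast hc
  obtain ⟨h1, h2⟩ := level_le_add φ c hr j
  set p := level φ.1 c r j with hp
  set q := level φ.1 c r (j + 1) with hq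
  have h1' : (p : ℝ) ≤ q + c := by exact_mod_cast h1
  have h2' : (q : ℝ) ≤ p + c := by exact_mod_cast h2
  refine ⟨(q - p) / c, ⟨?_, ?_⟩, ?_, ?_⟩
  · rw [le_div_iff₀ hc0]
    linarith
  · rw [div_le_iff₀ hc0]
    linarith
  · have e : (q - p) / c - cellSlope φ.1 r j =
        ((q - c * r * φ.1 ((j + 1 : ℕ) / r)) - (p - c * r * φ.1 (j / r))) / c := by
      rw [cellSlope]
      field_simp
      ring
    rw [e, abs_div, abs_of_pos hc0]
    gcongr
    have a1 := level_le (φ := φ) c r j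
    have a2 := level_le (φ := φ) c r (j + 1)
    have a3 := le_level (φ := φ) c r j
    have a4 := le_level (φ := φ) c r (j + 1)
    rw [abs_le]
    constructor <;> linarith
  · have hu : blockUps φ.1 c r j = c + q - p := rfl
    have hs : c + q - p + (c + p - q) = 2 * c := by omega
    have h := two_pow_mul_exp_le_choose (u := c + q - p) (v := c + p - q) (by omega)
    have cu : ((c + q - p : ℕ) : ℝ) = c + q - p := by
      rw [Nat.cast_sub (by omega)]
      push_cast
      ring
    have cv : ((c + p - q : ℕ) : ℝ) = c + p - q := by
      rw [Nat.cast_sub (by omega)]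
      push_cast
      ring
    rw [hs, cu, cv, pow_mul] at h
    have e1 : ((c + q - p - (c + p - q)) / (c + q - p + (c + p - q)) : ℝ) = (q - p) / c := by
      rw [show (c + q - p - (c + p - q) : ℝ) = 2 * (q - p) by ring,
        show (c + q - p + (c + p - q) : ℝ) = 2 * c by ring, mul_div_mul_left _ _ two_ne_zero]
    have e2 : (c + q - p + (c + p - q) + 1 : ℝ) = 2 * c + 1 := by ring
    rw [e1, e2] at h
    push_cast at h
    rw [hu]
    norm_num at h ⊢
    exact h

lemma dyck_of_blocks {φ : Espace} {c r u : ℕ} (hr : 1 ≤ r) (hu : 2 * c + 2 ≤ u)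
    {A : Finset ℕ} (hA : A ⊆ Finset.range (u + 2 * c * r))
    (hup : ∀ j ≤ r, upCount A (u + 2 * c * j) = u + (c * j + level φ.1 c r j)) {i : ℕ}
    (hi : i ≤ 2 * (u + c * r)) : i ≤ 2 * upCount A i := by
  have h0 := hup 0 (Nat.zero_le r)
  have hr' := hup r le_rfl
  rw [level_zero, mul_zero, mul_zero, add_zero, add_zero, add_zero] at h0
  rw [level_self φ c hr, add_zero] at hr'
  rcases le_total i u with h | h
  · have := upCount_le_add_sub A h
    omega
  rcases le_total (u + 2 * c * r) i with h' | h'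
  · have := upCount_mono A h'
    omega
  rcases Nat.eq_zero_or_pos c with rfl | hc
  · simp only [mul_zero, zero_mul, add_zero] at h'
    obtain rfl : i = u := le_antisymm h' h
    omega
  set j := (i - u) / (2 * c) with hj
  have hj1 : 2 * c * j ≤ i - u := Nat.mul_div_le _ _
  have hj2 : i - u < 2 * c * (j + 1) := Nat.lt_mul_div_succ _ (by omega)
  have hjr : j ≤ r := by
    by_contra hlt
    have : 2 * c * (r + 1) ≤ 2 * c * j := Nat.mul_le_mul_left _ (by omega)
    rw [Nat.mul_succ] at this
    omega
  have h1 := upCount_mono A (show u + 2 * c * j ≤ i by omega)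
  rw [hup j hjr] at h1
  rw [Nat.mul_succ] at hj2
  have h2 : 2 * c * j = 2 * (c * j) := by ring
  omega

lemma abs_sub_le_of_blocks {φ ψ : Espace} {c r u : ℕ} (hc : 1 ≤ c) (hr : 1 ≤ r)
    (hψ : ∀ j ≤ r, ψ.1 ((u + 2 * c * j : ℕ) / (2 * (u + c * r : ℕ))) =
      (u + 2 * level φ.1 c r j) / (2 * (u + c * r : ℕ)))
    (t : ℝ) : |ψ.1 t - φ.1 t| ≤ (u + 3) / r := by
  have hr0 : (0 : ℝ) < r := by exact_mod_cast hr
  have hc1 : (1 : ℝ) ≤ c := by exact_mod_cast hc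
  by_cases ht : t ∈ Icc (0 : ℝ) 1
  swap
  · rw [ψ.2.2.2.2.2 t ht, φ.2.2.2.2.2 t ht, sub_zero, abs_zero]
    positivity
  set m : ℝ := 2 * (u + c * r : ℕ) with hm
  have hm' : m = 2 * u + 2 * c * r := by rw [hm]; push_cast; ring
  have hrm : (2 * r : ℝ) ≤ m := by
    have : (0 : ℝ) ≤ u := Nat.cast_nonneg u
    nlinarith
  have hm0 : 0 < m := by linarith
  set j := ⌊r * t⌋₊ with hj
  have hj1 : (j : ℝ) ≤ r * t := Nat.floor_le (mul_nonneg hr0.le ht.1)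
  have hj2 : r * t < j + 1 := Nat.lt_floor_add_one _
  have hjr' : (j : ℝ) ≤ r := hj1.trans (mul_le_of_le_one_right hr0.le ht.2)
  have hjr : j ≤ r := by exact_mod_cast hjr'
  set s : ℝ := j / r with hs
  have hs0 : 0 ≤ s := by positivity
  have hs1 : s ≤ 1 := by rw [hs, div_le_one hr0]; exact hjr'
  have hjs : (j : ℝ) = r * s := by rw [hs]; field_simp
  have hts : |t - s| ≤ 1 / r := by
    have e1 : s ≤ t := by rw [hs, div_le_iff₀ hr0]; linarith
    have e2 : t ≤ s + 1 / r := by rw [hs, ← add_div, le_div_iff₀ hr0]; linarith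
    rw [abs_le]
    constructor <;> linarith [one_div_pos.2 hr0]
  set v : ℝ := (u + 2 * c * j : ℕ) / m with hv
  have hu0 : (0 : ℝ) ≤ u := Nat.cast_nonneg u
  have hvs : |v - s| ≤ u / m := by
    have e : v - s = u * (1 - 2 * s) / m := by
      rw [hv, eq_div_iff hm0.ne', sub_mul, div_mul_cancel₀ _ hm0.ne', hm']
      push_cast
      rw [hjs]
      ring
    rw [e, abs_div, abs_of_pos hm0, abs_mul, abs_of_nonneg hu0]
    gcongr
    refine mul_le_of_le_one_right hu0 ?_
    rw [abs_le]
    constructor <;> linarith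
  have hφs : 0 ≤ φ.1 s ∧ φ.1 s ≤ 1 := by
    refine ⟨φ.2.2.1 s, ?_⟩
    have := abs_sub_le_of_lipschitz φ.lipschitz s 0
    rw [φ.2.2.2.1, sub_zero, sub_zero, abs_of_nonneg hs0] at this
    exact (le_abs_self _).trans (this.trans hs1)
  have hψv : |ψ.1 v - φ.1 s| ≤ (u + 2) / m := by
    have l1 := level_le (φ := φ) c r j
    have l2 := le_level (φ := φ) c r j
    rw [← hs] at l1 l2
    have e : ψ.1 v - φ.1 s = (u + 2 * level φ.1 c r j - m * φ.1 s) / m := by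
      rw [hv, hψ j hjr]
      field_simp
    rw [e, abs_div, abs_of_pos hm0, hm']
    gcongr
    rw [abs_le]
    constructor <;> nlinarith [hφs.1, hφs.2, mul_le_mul_of_nonneg_left hφs.2 hu0,
      mul_nonneg hu0 hφs.1]
  have h1 := abs_sub_le_of_lipschitz ψ.lipschitz t v
  have h2 := abs_sub_le_of_lipschitz φ.lipschitz s t
  have h3 := abs_sub_le t s v
  have h4 := abs_sub_le (ψ.1 t) (ψ.1 v) (φ.1 t)
  have h5 := abs_sub_le (ψ.1 v) (φ.1 s) (φ.1 t)
  rw [abs_sub_comm s t] at h2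
  rw [abs_sub_comm s v] at h3
  have h6 : (u + 2) / m + u / m ≤ (u + 1) / r := by
    rw [← add_div, div_le_div_iff₀ hm0 hr0]
    nlinarith
  have h7 : (u + 3 : ℝ) / r = (u + 1) / r + 1 / r + 1 / r := by ring
  linarith

lemma prod_choose_le_card_avoiders {phi : ∀ n : ℕ, Equiv.Perm (Fin n) → Espace}
    (hphi : ∀ n : ℕ, 1 ≤ n → ∀ σ : Equiv.Perm (Fin n), Avoids231 σ →
      completedGraph (fcurve σ) = excursionGraph ⇑(phi n σ).1)
    (φ : Espace) {O : Set Espace} {δ : ℝ} (hO : ∀ ψ : Espace, (∀ t, |ψ.1 t - φ.1 t| ≤ δ) → ψ ∈ O)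
    {c r u : ℕ} (hc : 1 ≤ c) (hr : 1 ≤ r) (hu : 2 * c + 2 ≤ u) (hδ : (u + 3) / r ≤ δ) :
    ∏ j ∈ Finset.range r, (2 * c).choose (blockUps φ.1 c r j) ≤
      (avoiders phi (u + c * r) O).card := by
  obtain ⟨W, hcard, hW⟩ := exists_family_upCount u (2 * c) (blockUps φ.1 c r) r
  rw [← hcard]
  refine (Finset.card_le_card (t := (avoiders phi (u + c * r) O).image upSet) ?_).trans
    Finset.card_image_le
  intro A hA
  obtain ⟨hsub, hup⟩ := hW A hA
  simp only [sum_blockUps φ c hr] at hup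
  have hle : u + 2 * c * r ≤ 2 * (u + c * r) := by
    have : 2 * c * r = 2 * (c * r) := by ring
    omega
  have hAcard : A.card = u + c * r := by
    rw [← upCount_of_subset hsub le_rfl, hup r le_rfl, level_self φ c hr, add_zero]
  obtain ⟨σ, hσ, rfl⟩ := exists_avoids231_upSet (hsub.trans (Finset.range_mono hle)) hAcard
    fun i hi => dyck_of_blocks hr hu hsub hup hi
  refine Finset.mem_image.2 ⟨σ, Finset.mem_filter.2 ⟨Finset.mem_univ _, hσ, hO _ fun t => ?_⟩, rfl⟩
  refine (abs_sub_le_of_blocks hc hr (fun j hj => ?_) t).trans hδ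
  have hn : 1 ≤ u + c * r := by omega
  have hj' : u + 2 * c * j ≤ 2 * (u + c * r) :=
    (Nat.add_le_add_left (Nat.mul_le_mul_left _ hj) u).trans hle
  rw [excursion_apply_vertex hn σ (hphi _ hn σ hσ) hj', hup j hj]
  congr 1
  push_cast
  ring

lemma prod_choose_blockUps_ge (φ : Espace) {c : ℕ} (hc : 1 ≤ c) {r : ℕ} (hr : 1 ≤ r) {η : ℝ}
    (hη : ∀ x ∈ Icc (-1 : ℝ) 1, ∀ y ∈ Icc (-1 : ℝ) 1, |x - y| ≤ 1 / c → |Jfun x - Jfun y| ≤ η)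
    (hlog : Real.log (2 * c + 1) ≤ c * η) :
    4 ^ (c * r) * Real.exp (-(c * r * (realRate φ + 3 * η))) ≤
      ((∏ j ∈ Finset.range r, (2 * c).choose (blockUps φ.1 c r j) : ℕ) : ℝ) := by
  have hr0 : (0 : ℝ) < r := by exact_mod_cast hr
  have hc0 : (0 : ℝ) < c := by exact_mod_cast hc
  have hblock : ∀ j, 4 ^ c * Real.exp (-(2 * c * (Jfun (cellSlope φ.1 r j) + η) + c * η)) ≤
      ((2 * c).choose (blockUps φ.1 c r j) : ℝ) := by
    intro j
    obtain ⟨y, hy, hyc, h⟩ := choose_blockUps_ge φ hc hr j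
    have h1 := (abs_le.1 (hη y hy _ (cellSlope_mem φ.lipschitz hr j) hyc)).2
    have h2 : (2 * c + 1 : ℝ) * Real.exp (-(c * η)) ≤ 1 := by
      rw [← Real.exp_log (by positivity : (0 : ℝ) < 2 * c + 1), ← Real.exp_add, Real.exp_le_one_iff]
      linarith
    calc 4 ^ c * Real.exp (-(2 * c * (Jfun (cellSlope φ.1 r j) + η) + c * η))
        = 4 ^ c * Real.exp (-(2 * c * (Jfun (cellSlope φ.1 r j) + η))) * Real.exp (-(c * η)) := by
          rw [neg_add, Real.exp_add]
          ring
      _ ≤ 4 ^ c * Real.exp (-(2 * c * Jfun y)) * Real.exp (-(c * η)) := by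
          gcongr
          linarith
      _ ≤ (2 * c + 1) * ((2 * c).choose (blockUps φ.1 c r j) : ℝ) * Real.exp (-(c * η)) := by
          gcongr
      _ = ((2 * c + 1) * Real.exp (-(c * η))) * ((2 * c).choose (blockUps φ.1 c r j) : ℝ) := by
          ring
      _ ≤ 1 * ((2 * c).choose (blockUps φ.1 c r j) : ℝ) := by gcongr
      _ = _ := one_mul _
  have hprod : ∏ j ∈ Finset.range r,
      (4 ^ c * Real.exp (-(2 * c * (Jfun (cellSlope φ.1 r j) + η) + c * η))) ≤
      ((∏ j ∈ Finset.range r, (2 * c).choose (blockUps φ.1 c r j) : ℕ) : ℝ) := by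
    rw [Nat.cast_prod]
    exact Finset.prod_le_prod (fun j _ => by positivity) fun j _ => hblock j
  refine le_trans ?_ hprod
  rw [Finset.prod_mul_distrib, Finset.prod_const, Finset.card_range, ← pow_mul, ← Real.exp_sum]
  gcongr
  have h1 := gridRate_le φ.lipschitz hr
  have h2 : ∑ j ∈ Finset.range r, -(2 * c * (Jfun (cellSlope φ.1 r j) + η) + c * η) =
      -(c * r * (gridRate r φ.1 + 3 * η)) := by
    have e : ∀ j, -(2 * c * (Jfun (cellSlope φ.1 r j) + η) + c * η) =
        -(2 * c * r) * (Jfun (cellSlope φ.1 r j) / r) - 3 * c * η := fun j => by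
      field_simp
      ring
    rw [Finset.sum_congr rfl fun j _ => e j, Finset.sum_sub_distrib, ← Finset.mul_sum,
      Finset.sum_const, Finset.card_range, nsmul_eq_mul, gridRate]
    ring
  rw [h2]
  have h3 : gridRate r φ.1 ≤ realRate φ := h1
  gcongr

lemma exists_block_length {η : ℝ} (hη : 0 < η) :
    ∃ c : ℕ, 1 ≤ c ∧ Real.log (2 * c + 1) ≤ c * η ∧
      ∀ x ∈ Icc (-1 : ℝ) 1, ∀ y ∈ Icc (-1 : ℝ) 1, |x - y| ≤ 1 / c → |Jfun x - Jfun y| ≤ η := by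
  have huc := isCompact_Icc.uniformContinuousOn_of_continuous
    (continuous_Jfun.continuousOn (s := Icc (-1 : ℝ) 1))
  rw [Metric.uniformContinuousOn_iff] at huc
  obtain ⟨δ, hδ, huc⟩ := huc η hη
  have h1 : ∀ᶠ c : ℕ in atTop, 1 / (c : ℝ) < δ :=
    tendsto_one_div_atTop_nhds_zero_nat.eventually_lt_const hδ
  have h2 : ∀ᶠ c : ℕ in atTop, Real.log (2 * c + 1) ≤ c * η := by
    have ho := Real.isLittleO_log_id_atTop.def (half_pos (half_pos hη))
    have ht : Tendsto (fun c : ℕ => (2 * c + 1 : ℝ)) atTop atTop :=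
      tendsto_atTop_add_const_right _ _
        (tendsto_natCast_atTop_atTop.const_mul_atTop zero_lt_two)
    filter_upwards [ht.eventually ho, eventually_ge_atTop 1] with c hc hc1
    have hc1' : (1 : ℝ) ≤ c := by exact_mod_cast hc1
    rw [id, Real.norm_eq_abs, Real.norm_eq_abs, abs_of_pos (by positivity : (0 : ℝ) < 2 * c + 1)] at hc
    have := (le_abs_self _).trans hc
    nlinarith
  obtain ⟨c, ⟨h1, h2⟩, h3⟩ := ((h1.and h2).and (eventually_ge_atTop 1)).exists
  refine ⟨c, h3, h2, fun x hx y hy hxy => ?_⟩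
  have := huc x hx y hy (by rw [Real.dist_eq]; linarith)
  rw [Real.dist_eq] at this
  exact this.le

lemma exists_uniform_ball {O : Set Espace} (hO : IsOpen O) {φ : Espace} (hφ : φ ∈ O) :
    ∃ δ > 0, ∀ ψ : Espace, (∀ t, |ψ.1 t - φ.1 t| ≤ δ) → ψ ∈ O := by
  obtain ⟨U, hU, rfl⟩ := isOpen_induced_iff.1 hO
  obtain ⟨δ, hδ, hball⟩ := Metric.isOpen_iff.1 hU φ.1 hφ
  refine ⟨δ / 2, half_pos hδ, fun ψ hψ => hball ?_⟩
  rw [Metric.mem_ball]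
  exact ((BoundedContinuousFunction.dist_le (half_pos hδ).le).2 hψ).trans_lt (half_lt_self hδ)

lemma eventually_card_avoiders_ge {phi : ∀ n : ℕ, Equiv.Perm (Fin n) → Espace}
    (hphi : ∀ n : ℕ, 1 ≤ n → ∀ σ : Equiv.Perm (Fin n), Avoids231 σ →
      completedGraph (fcurve σ) = excursionGraph ⇑(phi n σ).1)
    {O : Set Espace} (hO : IsOpen O) {φ : Espace} (hφ : φ ∈ O) {ε : ℝ} (hε : 0 < ε) :
    ∀ᶠ n : ℕ in atTop,
      4 ^ n * Real.exp (-(n * (realRate φ + ε))) ≤ ((avoiders phi n O).card : ℝ) := by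
  obtain ⟨δ, hδ, hball⟩ := exists_uniform_ball hO hφ
  obtain ⟨c, hc, hlog, hη⟩ := exists_block_length (by positivity : 0 < ε / 6)
  have hr : Tendsto (fun n : ℕ => (n - (2 * c + 2)) / c) atTop atTop :=
    (Nat.tendsto_div_const_atTop (by omega)).comp (tendsto_sub_atTop_nat _)
  have hr1 : ∀ᶠ n : ℕ in atTop, (3 * c + 5 : ℝ) / ((n - (2 * c + 2)) / c : ℕ) < δ :=
    (Tendsto.comp (tendsto_const_div_atTop_nhds_zero_nat _) hr).eventually_lt_const hδ
  have hlarge : ∀ᶠ n : ℕ in atTop, (4 : ℝ) ^ (3 * c + 2) ≤ Real.exp (n * (ε / 2)) :=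
    ((Real.tendsto_exp_atTop.comp
      (tendsto_natCast_atTop_atTop.atTop_mul_const (half_pos hε))).eventually_ge_atTop _)
  filter_upwards [hr1, hlarge, hr.eventually_ge_atTop 1, eventually_ge_atTop (2 * c + 2)]
    with n h1 h2 h3 h4
  set r := (n - (2 * c + 2)) / c with hrdef
  have h5 : c * r ≤ n - (2 * c + 2) := Nat.mul_div_le _ _
  have h6 : n - (2 * c + 2) < c * (r + 1) := Nat.lt_mul_div_succ _ (by omega)
  rw [Nat.mul_succ] at h6
  obtain ⟨u, hu⟩ : ∃ u, n = u + c * r := ⟨n - c * r, by omega⟩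
  have hu1 : 2 * c + 2 ≤ u := by omega
  have hu2 : u ≤ 3 * c + 2 := by omega
  have hu2' : (u : ℝ) ≤ 3 * c + 2 := by exact_mod_cast hu2
  have h7 := prod_choose_le_card_avoiders hphi φ hball hc h3 hu1 (h1.le.trans'
    (div_le_div_of_nonneg_right (by linarith) (Nat.cast_nonneg _)))
  have h8 := prod_choose_blockUps_ge φ hc h3 hη hlog
  rw [← hu] at h7
  refine le_trans ?_ (Nat.cast_le.2 h7)
  refine le_trans ?_ h8
  have hR := realRate_nonneg φ
  have hn : (n : ℝ) = u + c * r := by rw [hu]; push_cast; ring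
  have hp : (4 : ℝ) ^ n = 4 ^ u * 4 ^ (c * r) := by rw [← pow_add, ← hu]
  rw [hn] at h2 ⊢
  have h9 : (4 : ℝ) ^ u ≤ Real.exp ((u + c * r) * (ε / 2)) :=
    (pow_le_pow_right₀ (by norm_num) hu2).trans h2
  calc (4 : ℝ) ^ n * Real.exp (-((u + c * r) * (realRate φ + ε)))
      = 4 ^ (c * r) * (4 ^ u * Real.exp (-((u + c * r) * (realRate φ + ε)))) := by
        rw [hp]
        ring
    _ ≤ 4 ^ (c * r) * (Real.exp ((u + c * r) * (ε / 2)) *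
          Real.exp (-((u + c * r) * (realRate φ + ε)))) := by gcongr
    _ ≤ 4 ^ (c * r) * Real.exp (-(c * r * (realRate φ + 3 * (ε / 6)))) := by
        rw [← Real.exp_add]
        gcongr
        have : (0 : ℝ) ≤ u := Nat.cast_nonneg u
        nlinarith [mul_nonneg this hR, mul_nonneg this hε.le]

/-- The zero excursion. -/
def zeroExcursion : Espace :=
  ⟨0, LipschitzWith.const' 0, fun _ => le_rfl, rfl, rfl, fun _ _ => rfl⟩

lemma realRate_zeroExcursion : realRate zeroExcursion = 0 := by
  have h : (⇑zeroExcursion.1 : ℝ → ℝ) = fun _ => 0 := rfl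
  simp [realRate, h, Jfun_zero]

lemma probUnif231_eq (phi : ∀ n : ℕ, Equiv.Perm (Fin n) → Espace) {n : ℕ} (S : Set Espace)
    (hn : 0 < ((avoiders phi n univ).card : ℝ)) :
    probUnif231 phi n S =
      ENNReal.ofReal ((avoiders phi n S).card / (avoiders phi n univ).card) := by
  rw [ENNReal.ofReal_div_of_pos hn, ENNReal.ofReal_natCast, ENNReal.ofReal_natCast]
  simp [probUnif231, avoiders]

lemma eventually_card_avoiders_univ_ge {phi : ∀ n : ℕ, Equiv.Perm (Fin n) → Espace}
    (hphi : ∀ n : ℕ, 1 ≤ n → ∀ σ : Equiv.Perm (Fin n), Avoids231 σ →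
      completedGraph (fcurve σ) = excursionGraph ⇑(phi n σ).1) {ε : ℝ} (hε : 0 < ε) :
    ∀ᶠ n : ℕ in atTop, 4 ^ n * Real.exp (-(n * ε)) ≤ ((avoiders phi n univ).card : ℝ) := by
  have h := eventually_card_avoiders_ge hphi isOpen_univ (mem_univ zeroExcursion) hε
  simpa only [realRate_zeroExcursion, zero_add] using h

lemma coe_le_inv_mul_log {n : ℕ} (hn : 1 ≤ n) {z : ℝ} {p : ENNReal}
    (h : ENNReal.ofReal (Real.exp (n * z)) ≤ p) :
    (z : EReal) ≤ (((n : ℝ)⁻¹ : ℝ) : EReal) * ENNReal.log p := by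
  have hn0 : (n : ℝ) ≠ 0 := by
    have : n ≠ 0 := by omega
    exact_mod_cast this
  have h1 := ENNReal.log_monotone h
  rw [ENNReal.log_ofReal_of_pos (Real.exp_pos _), Real.log_exp] at h1
  calc (z : EReal) = (((n : ℝ)⁻¹ : ℝ) : EReal) * ((n * z : ℝ) : EReal) := by
        rw [← EReal.coe_mul, inv_mul_cancel_left₀ hn0]
    _ ≤ _ := mul_le_mul_of_nonneg_left h1 (by exact_mod_cast inv_nonneg.2 (Nat.cast_nonneg n))

lemma inv_mul_log_le_coe {n : ℕ} (hn : 1 ≤ n) {z : ℝ} {p : ENNReal}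
    (h : p ≤ ENNReal.ofReal (Real.exp (n * z))) :
    (((n : ℝ)⁻¹ : ℝ) : EReal) * ENNReal.log p ≤ (z : EReal) := by
  have hn0 : (n : ℝ) ≠ 0 := by
    have : n ≠ 0 := by omega
    exact_mod_cast this
  have h1 := ENNReal.log_monotone h
  rw [ENNReal.log_ofReal_of_pos (Real.exp_pos _), Real.log_exp] at h1
  calc _ ≤ (((n : ℝ)⁻¹ : ℝ) : EReal) * ((n * z : ℝ) : EReal) :=
        mul_le_mul_of_nonneg_left h1 (by exact_mod_cast inv_nonneg.2 (Nat.cast_nonneg n))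
    _ = z := by rw [← EReal.coe_mul, inv_mul_cancel_left₀ hn0]

lemma exists_card_avoiders_le {phi : ∀ n : ℕ, Equiv.Perm (Fin n) → Espace}
    (hphi : ∀ n : ℕ, 1 ≤ n → ∀ σ : Equiv.Perm (Fin n), Avoids231 σ →
      completedGraph (fcurve σ) = excursionGraph ⇑(phi n σ).1)
    {F : Set Espace} (hF : IsClosed F) {a : ℝ} (ha : ∀ φ ∈ F, a < realRate φ) :
    ∃ C : ℝ, ∀ n : ℕ, 1 ≤ n →
      ((avoiders phi n F).card : ℝ) ≤ C * Real.exp (-(n * a)) * 4 ^ n := by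
  choose! K hK θ hθ using fun φ (hφ : φ ∈ F) => exists_tilt_gt (ha φ hφ)
  obtain ⟨T, hTF, hT⟩ := hF.isCompact.elim_nhds_subcover
    (fun φ => {ψ : Espace | a < tilt (K φ) (θ φ) ψ.1}) fun φ hφ =>
      (isOpen_lt continuous_const (continuous_tilt (K φ) (θ φ))).mem_nhds (hθ φ hφ)
  refine ⟨∑ φ ∈ T, Real.exp (tiltError (K φ) (θ φ)), fun n hn => ?_⟩
  have hsub : avoiders phi n F ⊆
      T.biUnion fun φ => avoiders phi n {ψ : Espace | a ≤ tilt (K φ) (θ φ) ψ.1} := by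
    intro σ hσ
    obtain ⟨-, h1, h2⟩ := Finset.mem_filter.1 hσ
    obtain ⟨φ, hφ, h3⟩ := mem_iUnion₂.1 (hT h2)
    have h4 : a ≤ tilt (K φ) (θ φ) (phi n σ).1 := le_of_lt h3
    exact Finset.mem_biUnion.2 ⟨φ, hφ, Finset.mem_filter.2 ⟨Finset.mem_univ _, h1, h4⟩⟩
  calc ((avoiders phi n F).card : ℝ)
      ≤ ∑ φ ∈ T, ((avoiders phi n {ψ : Espace | a ≤ tilt (K φ) (θ φ) ψ.1}).card : ℝ) := by
        exact_mod_cast (Finset.card_le_card hsub).trans Finset.card_biUnion_le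
    _ ≤ ∑ φ ∈ T, Real.exp (tiltError (K φ) (θ φ)) * Real.exp (-(n * a)) * 4 ^ n :=
        Finset.sum_le_sum fun φ hφ => card_avoiders_tilt_le hphi hn (hK φ (hTF φ hφ)) _ _
    _ = _ := by rw [Finset.sum_mul, Finset.sum_mul]

lemma eventually_probUnif231_le {phi : ∀ n : ℕ, Equiv.Perm (Fin n) → Espace}
    (hphi : ∀ n : ℕ, 1 ≤ n → ∀ σ : Equiv.Perm (Fin n), Avoids231 σ →
      completedGraph (fcurve σ) = excursionGraph ⇑(phi n σ).1)
    {F : Set Espace} (hF : IsClosed F) {a b : ℝ} (ha : ∀ φ ∈ F, a < realRate φ) (hb : b < a) :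
    ∀ᶠ n : ℕ in atTop, probUnif231 phi n F ≤ ENNReal.ofReal (Real.exp (n * -b)) := by
  obtain ⟨C, hC⟩ := exists_card_avoiders_le hphi hF ha
  have hε : 0 < (a - b) / 2 := by linarith
  have hlarge : ∀ᶠ n : ℕ in atTop, C ≤ Real.exp (n * ((a - b) / 2)) :=
    (Real.tendsto_exp_atTop.comp
      (tendsto_natCast_atTop_atTop.atTop_mul_const hε)).eventually_ge_atTop _
  filter_upwards [hlarge, eventually_card_avoiders_univ_ge hphi hε, eventually_ge_atTop 1]
    with n h1 h2 h3
  have hpos : 0 < ((avoiders phi n univ).card : ℝ) := lt_of_lt_of_le (by positivity) h2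
  rw [probUnif231_eq phi F hpos]
  refine ENNReal.ofReal_le_ofReal ?_
  rw [div_le_iff₀ hpos]
  calc ((avoiders phi n F).card : ℝ) ≤ C * Real.exp (-(n * a)) * 4 ^ n := hC n h3
    _ ≤ Real.exp (n * ((a - b) / 2)) * Real.exp (-(n * a)) * 4 ^ n := by gcongr
    _ = Real.exp (n * -b) * (4 ^ n * Real.exp (-(n * ((a - b) / 2)))) := by
        rw [mul_left_comm, ← Real.exp_add, ← Real.exp_add, mul_comm]
        congr 2
        ring
    _ ≤ _ := by gcongr

lemma eventually_le_probUnif231 {phi : ∀ n : ℕ, Equiv.Perm (Fin n) → Espace}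
    (hphi : ∀ n : ℕ, 1 ≤ n → ∀ σ : Equiv.Perm (Fin n), Avoids231 σ →
      completedGraph (fcurve σ) = excursionGraph ⇑(phi n σ).1)
    {O : Set Espace} (hO : IsOpen O) {φ : Espace} (hφ : φ ∈ O) {z : ℝ} (hz : z < -realRate φ) :
    ∀ᶠ n : ℕ in atTop, ENNReal.ofReal (Real.exp (n * z)) ≤ probUnif231 phi n O := by
  filter_upwards [eventually_card_avoiders_univ_ge hphi zero_lt_one,
    eventually_card_avoiders_ge hphi hO hφ (by linarith : 0 < -realRate φ - z)] with n h1 h2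
  have hpos : 0 < ((avoiders phi n univ).card : ℝ) := lt_of_lt_of_le (by positivity) h1
  rw [probUnif231_eq phi O hpos]
  refine ENNReal.ofReal_le_ofReal ?_
  rw [le_div_iff₀ hpos]
  refine le_trans ?_ h2
  rw [mul_comm, show -(n * (realRate φ + (-realRate φ - z))) = n * z by ring]
  gcongr
  exact card_avoiders_le phi n univ

/-- Large deviation principle for the excursions of uniform `231`-avoiding
permutations, at speed `n`, with rate function `H^{231}(φ) = 2∫₀¹ J(φ') dt`.
Here `phi n σ` is the normalized excursion `φ_σ` of `σ`, characterized by the fact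
that the completed graph of the normalized RLM curve `f_σ` is the rotated-flipped
graph of `φ_σ`. -/
theorem LDP_uniform_231 (phi : ∀ n : ℕ, Equiv.Perm (Fin n) → Espace)
    (hphi : ∀ n : ℕ, 1 ≤ n → ∀ σ : Equiv.Perm (Fin n), Avoids231 σ →
      completedGraph (fcurve σ) = excursionGraph ⇑(phi n σ).1) :
    SatisfiesLDP (probUnif231 phi) H231 := by
  refine ⟨lowerSemicontinuous_H231, fun φ => ?_, fun F hF => ?_, fun O hO => ?_⟩
  · rw [H231_eq]
    exact_mod_cast realRate_nonneg φ
  · rw [EReal.le_neg]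
    refine le_of_forall_lt fun c hc => ?_
    obtain ⟨b, hcb, hb⟩ := EReal.lt_iff_exists_real_btwn.1 hc
    obtain ⟨a, hba, ha⟩ := EReal.lt_iff_exists_real_btwn.1 hb
    refine hcb.trans_le ?_
    rw [EReal.le_neg, ← EReal.coe_neg]
    have ha' : ∀ φ ∈ F, a < realRate φ := fun φ hφ =>
      EReal.coe_lt_coe_iff.1 (ha.trans_le (iInf₂_le φ hφ))
    refine limsup_le_of_le (by isBoundedDefault) ?_
    filter_upwards [eventually_probUnif231_le hphi hF ha' (EReal.coe_lt_coe_iff.1 hba),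
      eventually_ge_atTop 1] with n h1 h2
    exact inv_mul_log_le_coe h2 h1
  · rw [EReal.neg_le]
    refine le_iInf₂ fun φ hφ => ?_
    rw [EReal.neg_le, H231_eq, ← EReal.coe_neg]
    refine le_of_forall_lt fun c hc => ?_
    obtain ⟨z, hcz, hz⟩ := EReal.lt_iff_exists_real_btwn.1 hc
    refine hcz.trans_le (le_liminf_of_le (by isBoundedDefault) ?_)
    filter_upwards [eventually_le_probUnif231 hphi hO hφ (EReal.coe_lt_coe_iff.1 hz),
      eventually_ge_atTop 1] with n h1 h2
    exact coe_le_inv_mul_log h2 h1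

end
end
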